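/- Let G be a Cohen–Macaulay cactus graph (i.e., R/I(G) is Cohen–Macaulay and every edge of G belongs to at most one cycle). Then J(G)^s is weakly polymatroidal for all s ≥ 1 (in a suitable ordering of the variables). -/

import Mathlib

/-!
STATEMENT 19: Let `G` be a Cohen–Macaulay cactus graph (every edge of `G` belongs to at
most one cycle and `R/I(G)` is Cohen–Macaulay).  Then `J(G)^s` is weakly polymatroidal
for all `s ≥ 1`, in a suitable ordering of the variables.
-/
open MvPolynomial

namespace Stmt

variable (K : Type) [Field K]

/-- `F` is a vertex cover of the graph `G`. -/
def IsVertexCover {V : Type} (G : SimpleGraph V) (F : Finset V) : Prop :=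
  ∀ v w, G.Adj v w → v ∈ F ∨ w ∈ F

/-- `F` is a minimal vertex cover of the graph `G`. -/
def IsMinimalVertexCover {V : Type} (G : SimpleGraph V) (F : Finset V) : Prop :=
  IsVertexCover G F ∧ ∀ F' ⊆ F, IsVertexCover G F' → F' = F

/-- The vertex cover ideal `J(G)`, generated by the monomials `∏_{v ∈ F} x_v`
with `F` a minimal vertex cover of `G`. -/
noncomputable def coverIdeal {V : Type} (G : SimpleGraph V) : Ideal (MvPolynomial V K) :=
  Ideal.span { m | ∃ F : Finset V, IsMinimalVertexCover G F ∧ m = ∏ v ∈ F, X v }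

/-- The `s`-th symbolic power `J(G)^{(s)} = ⋂_{{v,w} ∈ E(G)} (x_v, x_w)^s`. -/
noncomputable def symbolicCoverPower {V : Type} (G : SimpleGraph V) (s : ℕ) :
    Ideal (MvPolynomial V K) :=
  ⨅ (v : V) (w : V) (_ : G.Adj v w), (Ideal.span {X v, X w} : Ideal (MvPolynomial V K)) ^ s

/-- `a` is the exponent vector of an element of the minimal monomial generating set `G(I)`
of the monomial ideal `I`: the monomial `x^a` lies in `I` and no proper monomial divisor
of it lies in `I`. -/
def IsMonoMinGen {τ : Type} (I : Ideal (MvPolynomial τ K)) (a : τ →₀ ℕ) : Prop :=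
  (monomial a (1 : K)) ∈ I ∧
    ∀ b : τ →₀ ℕ, (monomial b (1 : K)) ∈ I → b ≤ a → b = a

/-- A monomial ideal `I` (not necessarily generated in one degree) is weakly polymatroidal
with respect to a strict order `lt` on the variables (where `lt p q` means that the
variable `x_p` precedes, i.e. is greater than, the variable `x_q`):  for all exponent
vectors `a b` of minimal monomial generators `u = x^a`, `v = x^b` of `I`, if `a` and `b`
agree on all variables preceding `q` and `a q < b q`, then there is a variable `p`
coming after `q` such that `x_q · u / x_p` is again a minimal monomial generator. -/
def WeaklyPolymatroidalWrt {τ : Type} [DecidableEq τ] (lt : τ → τ → Prop)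
    (I : Ideal (MvPolynomial τ K)) : Prop :=
  ∀ a b : τ →₀ ℕ, IsMonoMinGen K I a → IsMonoMinGen K I b →
    ∀ q : τ, (∀ p, lt p q → a p = b p) → a q < b q →
      ∃ p, lt q p ∧ 0 < a p ∧
        IsMonoMinGen K I (a + Finsupp.single q 1 - Finsupp.single p 1)

/-- `G` is unmixed: all minimal vertex covers have the same cardinality. -/
def IsUnmixed {V : Type} (G : SimpleGraph V) : Prop :=
  ∀ F F' : Finset V, IsMinimalVertexCover G F → IsMinimalVertexCover G F' →
    F.card = F'.card

/-- A subgraph of `G` which is a cycle: it is connected and every one of its vertices has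
exactly two neighbours in it. -/
def IsCycleSubgraph {V : Type} (G : SimpleGraph V) (H : G.Subgraph) : Prop :=
  H.Connected ∧ ∀ v ∈ H.verts, (H.neighborSet v).ncard = 2

/-- `G` is a cactus graph: every edge of `G` belongs to at most one cycle. -/
def IsCactus {V : Type} (G : SimpleGraph V) : Prop :=
  ∀ C₁ C₂ : G.Subgraph, IsCycleSubgraph G C₁ → IsCycleSubgraph G C₂ →
    ∀ e ∈ C₁.edgeSet, e ∈ C₂.edgeSet → C₁ = C₂

/-- `G` is chordal: every cycle of length at least 4 has a chord. -/
def IsChordal {V : Type} (G : SimpleGraph V) : Prop :=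
  ∀ (v : V) (c : G.Walk v v), c.IsCycle → 4 ≤ c.length →
    ∃ a b, a ∈ c.support ∧ b ∈ c.support ∧ G.Adj a b ∧ s(a, b) ∉ c.edges

/-- The independence complex of `G`: faces are the independent sets of `G`. -/
def indepCpx {V : Type} (G : SimpleGraph V) : Finset V → Prop :=
  fun F => ∀ v ∈ F, ∀ w ∈ F, ¬ G.Adj v w

/-- The edge ideal `I(G)`, generated by the monomials `x_v x_w` over edges `{v,w}`. -/
noncomputable def edgeIdeal {V : Type} (G : SimpleGraph V) : Ideal (MvPolynomial V K) :=
  Ideal.span { m | ∃ v w, G.Adj v w ∧ m = X v * X w }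

/-- `R ⧸ I` is a Cohen–Macaulay ring, expressed (for a graded quotient of a polynomial
ring) by the existence of a regular sequence inside the graded maximal ideal
`m = (x_v : v)` whose length equals the Krull dimension of `R ⧸ I`
(i.e. `depth_m (R ⧸ I) = dim (R ⧸ I)`). -/
def IsCohenMacaulayQuot {τ : Type} (I : Ideal (MvPolynomial τ K)) : Prop :=
  ∃ rs : List (MvPolynomial τ K),
    (∀ r ∈ rs, r ∈ Ideal.span (Set.range (X : τ → MvPolynomial τ K))) ∧
    RingTheory.Sequence.IsRegular (MvPolynomial τ K ⧸ I) rs ∧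
    ((rs.length : WithTop ℕ) : WithBot (WithTop ℕ)) = ringKrullDim (MvPolynomial τ K ⧸ I)

section Koszul
variable {R ι M M' : Type} [CommRing R] [AddCommGroup M] [Module R M]
  [AddCommGroup M'] [Module R M']

/-- The differential of the ordered Koszul cochain complex of the family `y`, acting on cochains
given as functions on lists of indices. -/
def kd (y : ι → R) : (List ι → M) → List ι → M
  | _, [] => 0
  | c, v :: l => y v • c l - kd y (fun t => c (v :: t)) l

lemma kd_nil (y : ι → R) (c : List ι → M) : kd y c [] = 0 := rfl

lemma kd_cons (y : ι → R) (c : List ι → M) (v : ι) (l : List ι) :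
    kd y c (v :: l) = y v • c l - kd y (fun t => c (v :: t)) l := rfl

lemma kd_zero (y : ι → R) (l : List ι) : kd y (fun _ => (0 : M)) l = 0 := by
  induction l with
  | nil => rfl
  | cons v l ih => simp [kd_cons, ih]

lemma kd_add (y : ι → R) (c c' : List ι → M) (l : List ι) :
    kd y (fun t => c t + c' t) l = kd y c l + kd y c' l := by
  induction l generalizing c c' with
  | nil => simp [kd_nil]
  | cons v l ih => simp only [kd_cons, ih, smul_add]; abel

lemma kd_smul (y : ι → R) (r : R) (c : List ι → M) (l : List ι) :
    kd y (fun t => r • c t) l = r • kd y c l := by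
  induction l generalizing c with
  | nil => simp [kd_nil]
  | cons v l ih => simp only [kd_cons, ih, smul_sub, smul_comm r (y v)]

lemma kd_sub (y : ι → R) (c c' : List ι → M) (l : List ι) :
    kd y (fun t => c t - c' t) l = kd y c l - kd y c' l := by
  have := kd_add y c (fun t => (-1 : R) • c' t) l
  rw [kd_smul] at this
  simpa [sub_eq_add_neg] using this

lemma kd_sum {κ : Type} (s : Finset κ) (y : ι → R) (c : κ → List ι → M) (l : List ι) :
    kd y (fun t => ∑ k ∈ s, c k t) l = ∑ k ∈ s, kd y (c k) l := by
  classical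
  induction s using Finset.induction_on with
  | empty => simpa using kd_zero y l
  | insert a s ha ih => simp only [Finset.sum_insert ha, kd_add, ih]

lemma kd_map (f : M →ₗ[R] M') (y : ι → R) (c : List ι → M) (l : List ι) :
    kd y (fun t => f (c t)) l = f (kd y c l) := by
  induction l generalizing c with
  | nil => simp [kd_nil]
  | cons v l ih => simp only [kd_cons, ih, map_sub, map_smul]

lemma kd_kd (y : ι → R) (c : List ι → M) (l : List ι) : kd y (kd y c) l = 0 := by
  induction l generalizing c with
  | nil => rfl
  | cons v l ih =>
    rw [kd_cons]
    simp only [kd_cons, kd_sub, kd_smul, ih]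
    abel

lemma kd_anticomm (y z : ι → R) (c : List ι → M) (l : List ι) :
    kd y (kd z c) l = - kd z (kd y c) l := by
  induction l generalizing c with
  | nil => simp [kd_nil]
  | cons v l ih =>
    rw [kd_cons, kd_cons]
    simp only [kd_cons, kd_sub, kd_smul, ih]
    abel

lemma kd_add_smul (y z : ι → R) (r : R) (c : List ι → M) (l : List ι) :
    kd (fun v => y v + r * z v) c l = kd y c l + r • kd z c l := by
  induction l generalizing c with
  | nil => simp [kd_nil]
  | cons v l ih =>
    simp only [kd_cons, ih, add_smul, mul_smul, smul_sub]
    abel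

/-- The differential at `l` only depends on the family on `l` and on the cochain on lists
one shorter than `l` with entries in `l`. -/
lemma kd_congr {y z : ι → R} {c c' : List ι → M} {l : List ι} {T : ι → Prop}
    (hl : ∀ v ∈ l, T v) (hy : ∀ v, T v → y v = z v)
    (h : ∀ t : List ι, (∀ v ∈ t, T v) → t.length + 1 = l.length → c t = c' t) :
    kd y c l = kd z c' l := by
  induction l generalizing c c' with
  | nil => rfl
  | cons v l ih =>
    have hT := hl v (by simp)
    rw [kd_cons, kd_cons, hy v hT, h l (fun w hw => hl w (by simp [hw])) (by simp),
      ih (c := fun t => c (v :: t)) (c' := fun t => c' (v :: t))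
        (fun w hw => hl w (by simp [hw]))]
    intro t ht hlen
    exact h _ (by simpa [hT] using ht) (by simp [← hlen])

lemma kd_contract [Fintype ι] (y s : ι → R) (c : List ι → M) (l : List ι) :
    (∑ v, s v * y v) • c l =
      kd y (fun t => ∑ v, s v • c (v :: t)) l + ∑ v, s v • kd y c (v :: l) := by
  simp only [kd_sum, kd_cons, kd_smul, smul_sub, Finset.sum_sub_distrib, Finset.sum_smul, mul_smul]
  abel

/-- Vanishing of the `i`-th Koszul cohomology. -/
def KExact (i : ℕ) (y : ι → R) (M : Type) [AddCommGroup M] [Module R M] : Prop :=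
  ∀ c : List ι → M, (∀ l, l.length = i + 1 → kd y c l = 0) →
    ∃ b : List ι → M, ∀ l, l.length = i → c l = kd y b l

lemma kd_divide (y : ι → R) {r : R} (hr : IsSMulRegular M r) (i : ℕ)
    (hex : ∀ j, j + 1 = i → KExact j y (QuotSMulTop r M)) (c β : List ι → M)
    (h : ∀ l, l.length = i → r • c l = kd y β l) :
    ∃ b : List ι → M, ∀ l, l.length = i → c l = kd y b l := by
  cases i with
  | zero =>
    refine ⟨0, fun l hl => ?_⟩
    have h1 := h l hl
    obtain rfl := List.length_eq_zero_iff.mp hl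
    rw [kd_nil] at h1 ⊢
    exact hr (by simpa using h1)
  | succ i =>
    let π : M →ₗ[R] QuotSMulTop r M := Submodule.mkQ _
    obtain ⟨b', hb'⟩ := hex i rfl (fun t => π (β t)) (by
      intro l hl
      rw [kd_map, ← h l hl]
      simp only [π, Submodule.mkQ_apply, Submodule.Quotient.mk_eq_zero]
      exact Submodule.smul_mem_pointwise_smul _ _ _ trivial)
    choose b hb using fun t => Submodule.mkQ_surjective _ (b' t)
    have hb2 : ∀ l : List ι, l.length = i → ∃ g : M, β l - kd y b l = r • g := by
      intro l hl
      have h1 : π (β l - kd y b l) = 0 := by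
        rw [map_sub, hb' l hl, ← kd_map]
        simp only [π, hb, sub_self]
      simp only [π, Submodule.mkQ_apply, Submodule.Quotient.mk_eq_zero] at h1
      obtain ⟨g, -, hg⟩ := h1
      exact ⟨g, hg.symm⟩
    choose! g hg using hb2
    refine ⟨g, fun l hl => hr ?_⟩
    change r • c l = r • kd y g l
    rw [h l hl, ← kd_smul, ← sub_eq_zero, ← kd_sub]
    rw [kd_congr (z := y) (c' := kd y b) (T := fun _ => True) (by simp) (by simp), kd_kd]
    intro t _ ht
    rw [← hg t (by omega)]
    abel

/-- A weakly regular sequence in the radical of the ideal generated by `y` forces the vanishing of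
low degree Koszul cohomology. -/
theorem kExact_of_isWeaklyRegular [Fintype ι] (y : ι → R) (rs : List R)
    (hrs : ∀ r ∈ rs, r ∈ (Ideal.span (Set.range y)).radical)
    (M : Type) [AddCommGroup M] [Module R M]
    (hreg : RingTheory.Sequence.IsWeaklyRegular M rs) (i : ℕ) (hi : i < rs.length) :
    KExact i y M := by
  induction rs generalizing M i with
  | nil => simp at hi
  | cons r rs ih =>
    rw [RingTheory.Sequence.isWeaklyRegular_cons_iff] at hreg
    obtain ⟨hr, hreg⟩ := hreg
    have hex : ∀ j, j + 1 = i → KExact j y (QuotSMulTop r M) := fun j hj =>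
      ih (fun r hr => hrs r (by simp [hr])) _ hreg j (by simp at hi; omega)
    intro c hc
    obtain ⟨N, hN⟩ := hrs r (by simp)
    obtain ⟨s, hs⟩ := (Ideal.mem_span_range_iff_exists_fun).mp hN
    have key : ∃ β : List ι → M, ∀ l, l.length = i → r ^ N • c l = kd y β l := by
      refine ⟨fun t => ∑ v, s v • c (v :: t), fun l hl => ?_⟩
      rw [← hs, kd_contract, Finset.sum_eq_zero (s := Finset.univ) (f := fun v => s v • _), add_zero]
      intro v _
      rw [hc _ (by simp [hl]), smul_zero]
    clear hN hs
    induction N with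
    | zero => simpa using key
    | succ N ihN =>
      obtain ⟨β, hβ⟩ := key
      exact ihN (kd_divide y hr i hex (fun l => r ^ N • c l) β
        (fun l hl => by rw [← mul_smul, ← pow_succ', hβ l hl]))

/-- Vanishing of Koszul cohomology over the indices in `T`, modulo the submodule `N`. -/
def RelExact (i : ℕ) (y : ι → R) (T : ι → Prop) (N : Submodule R M) : Prop :=
  ∀ c : List ι → M, (∀ l, (∀ v ∈ l, T v) → l.length = i + 1 → kd y c l = 0) →
    ∃ b : List ι → M, ∀ l, (∀ v ∈ l, T v) → l.length = i → c l - kd y b l ∈ N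

lemma kd_eq_zero_of_mem {y : ι → R} {l : List ι} {v : ι} (hv : v ∈ l) (hy : y v = 0)
    (c : List ι → M) (hc : ∀ t, v ∈ t → c t = 0) : kd y c l = 0 := by
  induction l generalizing c with
  | nil => rfl
  | cons w l ih =>
    rw [kd_cons]
    by_cases hw : w = v
    · subst hw
      have : (fun t => c (w :: t)) = fun _ => 0 := funext fun t => hc _ (by simp)
      rw [hy, this, kd_zero]
      simp
    · have hl : v ∈ l := by
        rcases List.mem_cons.mp hv with h | h
        · exact absurd h.symm hw
        · exact h
      rw [hc l hl, ih hl _ (fun t ht => hc _ (by simp [ht]))]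
      simp

lemma RelExact.erase [DecidableEq ι] {i : ℕ} {y : ι → R} {T : ι → Prop} {N : Submodule R M} {v : ι}
    (hv : ¬ T v) (h : RelExact (i + 1) y (fun w => w = v ∨ T w) N) :
    RelExact i y T (N ⊔ Ideal.span {y v} • (⊤ : Submodule R M)) := by
  classical
  intro c hc
  let c₀ : List ι → M := fun l => if ∀ w ∈ l, T w then c l else 0
  let δ : ι → R := Pi.single v 1
  let z : ι → R := fun w => if w = v then 0 else y w
  have hyz : y = fun w => z w + y v * δ w := by
    funext w
    by_cases hw : w = v
    · subst hw; simp [z, δ]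
    · simp [z, δ, hw]
  have hcv : ∀ t, v ∈ t → c₀ t = 0 := fun t ht => if_neg fun h' => hv (h' v ht)
  have hz : ∀ l, (∀ w ∈ l, w = v ∨ T w) → l.length = i + 1 → kd z c₀ l = 0 := by
    intro l hl hlen
    by_cases hvl : v ∈ l
    · exact kd_eq_zero_of_mem hvl (by simp [z]) _ hcv
    · have hT : ∀ w ∈ l, T w := fun w hw => (hl w hw).resolve_left fun h' => hvl (h' ▸ hw)
      rw [← hc l hT hlen]
      refine kd_congr hT (fun w hw => if_neg ?_) fun t ht _ => if_pos ht
      rintro rfl; exact hv hw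
  obtain ⟨B, hB⟩ := h (kd δ c₀) (by
    intro l hl hlen
    rw [hyz, kd_add_smul, kd_kd, kd_anticomm,
      kd_congr (z := δ) (c' := fun _ => 0) hl (fun _ _ => rfl)
        (fun t ht htl => hz t ht (by omega)), kd_zero]
    simp)
  refine ⟨fun t => (-1 : R) • B (v :: t), fun l hl hlen => ?_⟩
  have h1 := hB (v :: l) (by simpa using fun w hw => Or.inr (hl w hw)) (by simp [hlen])
  have h2 : kd δ c₀ (v :: l) = c l := by
    rw [kd_cons]
    have : (fun t => c₀ (v :: t)) = fun _ => 0 := funext fun t => hcv _ (by simp)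
    rw [this, kd_zero]
    simp [δ, c₀, if_pos hl]
  rw [h2, kd_cons] at h1
  have h3 : c l - kd y (fun t => (-1 : R) • B (v :: t)) l
      = (c l - (y v • B l - kd y (fun t => B (v :: t)) l)) + y v • B l := by
    rw [kd_smul, neg_one_smul]; abel
  rw [h3]
  exact Submodule.add_mem_sup h1
    (Submodule.smul_mem_smul (Ideal.mem_span_singleton_self _) trivial)

lemma RelExact.eraseFinset [DecidableEq ι] {y : ι → R} (S : Finset ι) (i : ℕ)
    (h : KExact (i + S.card) y M) :
    RelExact i y (fun w => w ∉ S)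
      (Ideal.span (y '' (S : Set ι)) • (⊤ : Submodule R M)) := by
  induction S using Finset.induction_on generalizing i with
  | empty =>
    intro c hc
    obtain ⟨b, hb⟩ := h c (fun l hl => hc l (by simp) (by simpa using hl))
    refine ⟨b, fun l _ hl => ?_⟩
    rw [hb l (by simpa using hl)]
    simp
  | insert v S hv ih =>
    rw [Finset.card_insert_of_notMem hv, ← add_assoc, add_right_comm] at h
    have h1 := ih (i + 1) h
    have h2 : RelExact i y (fun w => w ∉ insert v S) _ := RelExact.erase (v := v) (by simp)
      (N := Ideal.span (y '' (S : Set ι)) • (⊤ : Submodule R M)) (by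
        convert h1 using 2 with w
        by_cases hw : w = v
        · subst hw; simp [hv]
        · simp [hw])
    intro c hc
    obtain ⟨b, hb⟩ := h2 c hc
    have hle : Ideal.span (y '' (S : Set ι)) • (⊤ : Submodule R M) ⊔ Ideal.span {y v} • ⊤ ≤
        Ideal.span (y '' ((insert v S : Finset ι) : Set ι)) • ⊤ :=
      sup_le (Submodule.smul_mono_left (Ideal.span_mono (Set.image_mono (by simp))))
        (Submodule.smul_mono_left (Ideal.span_mono (by simp)))
    exact ⟨b, fun l hl hlen => hle (hb l hl hlen)⟩

end Koszul

section EdgeIdeal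
variable {V : Type}

/-- The vertices outside the closed neighbourhood of `S`. -/
def InLink (G : SimpleGraph V) (S : Finset V) (v : V) : Prop := v ∉ S ∧ ∀ s ∈ S, ¬ G.Adj s v

/-- The exponent vector of the squarefree monomial with support `F`. -/
noncomputable def sqf (F : Finset V) : V →₀ ℕ := ∑ v ∈ F, Finsupp.single v 1

lemma sqf_apply [DecidableEq V] (F : Finset V) (v : V) : sqf F v = if v ∈ F then 1 else 0 := by
  simp [sqf, Finsupp.finsetSum_apply, Finsupp.single_apply]

variable {K}

lemma coeff_eq_zero_of_mem_span {s : Set (MvPolynomial V K)} {e : V →₀ ℕ}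
    (hs : ∀ p ∈ s, ∀ e' ≤ e, coeff e' p = 0) {p : MvPolynomial V K} (hp : p ∈ Ideal.span s) :
    coeff e p = 0 := by
  classical
  have : ∀ e' ≤ e, coeff e' p = 0 := by
    refine Submodule.span_induction (p := fun p _ => ∀ e' ≤ e, coeff e' p = 0) hs (by simp)
      (fun p q _ _ hp hq e' he => by rw [coeff_add, hp e' he, hq e' he, add_zero]) ?_ hp
    intro a p _ hp e' he
    rw [smul_eq_mul, coeff_mul]
    refine Finset.sum_eq_zero fun x hx => ?_
    rw [hp, mul_zero]
    rw [Finset.HasAntidiagonal.mem_antidiagonal] at hx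
    exact le_trans (by rw [← hx]; exact le_add_self) he
  exact this e le_rfl

lemma X_mul_X_eq (v w : V) : (X v * X w : MvPolynomial V K) =
    monomial (Finsupp.single v 1 + Finsupp.single w 1) 1 := by
  simp [X, monomial_mul]

lemma monomial_mem_edgeIdeal {G : SimpleGraph V} {e : V →₀ ℕ} {v w : V} (h : G.Adj v w)
    (hv : 1 ≤ e v) (hw : 1 ≤ e w) (r : K) : monomial e r ∈ edgeIdeal K G := by
  classical
  have : e = (e - (Finsupp.single v 1 + Finsupp.single w 1)) +
      (Finsupp.single v 1 + Finsupp.single w 1) := by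
    refine (tsub_add_cancel_of_le fun u => ?_).symm
    have := h.ne
    simp only [Finsupp.add_apply, Finsupp.single_apply]
    split_ifs <;> subst_vars <;> first | omega | simp_all
  rw [this, ← mul_one r, ← monomial_mul, ← X_mul_X_eq]
  exact Ideal.mul_mem_left _ _ (Ideal.subset_span ⟨v, w, h, rfl⟩)

lemma card_le_ringKrullDim (G : SimpleGraph V) {M : Finset V}
    (hM : indepCpx G M) :
    (M.card : WithBot ℕ∞) ≤ ringKrullDim (MvPolynomial V K ⧸ edgeIdeal K G) := by
  classical
  let φ : MvPolynomial V K →ₐ[K] MvPolynomial {v // v ∈ M} K :=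
    aeval fun v => if h : v ∈ M then X ⟨v, h⟩ else 0
  have hker : ∀ p ∈ edgeIdeal K G, φ.toRingHom p = 0 := by
    intro p hp
    have : edgeIdeal K G ≤ RingHom.ker φ.toRingHom := by
      refine Ideal.span_le.mpr ?_
      rintro _ ⟨v, w, h, rfl⟩
      simp only [SetLike.mem_coe, RingHom.mem_ker, map_mul]
      simp only [φ, AlgHom.toRingHom_eq_coe, RingHom.coe_coe, aeval_X]
      by_cases hv : v ∈ M
      · have hw : w ∉ M := fun hw => hM v hv w hw h
        simp [hw]
      · simp [hv]
    exact this hp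
  have hsurj : Function.Surjective (Ideal.Quotient.lift (edgeIdeal K G) φ.toRingHom hker) := by
    refine Ideal.Quotient.lift_surjective_of_surjective _ _ fun q => ⟨rename Subtype.val q, ?_⟩
    simp only [φ, AlgHom.toRingHom_eq_coe, RingHom.coe_coe, aeval_rename]
    have : ((fun v => if h : v ∈ M then X ⟨v, h⟩ else 0) ∘ Subtype.val :
        {v // v ∈ M} → MvPolynomial {v // v ∈ M} K) = X := by
      funext v; simp
    rw [this, aeval_X_left_apply]
  have h1 := ringKrullDim_le_of_surjective _ hsurj
  rw [MvPolynomial.ringKrullDim_of_isNoetherianRing, ringKrullDim_eq_zero_of_field] at h1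
  simpa using h1

lemma card_le_length {G : SimpleGraph V} {M : Finset V} (hM : indepCpx G M)
    {rs : List (MvPolynomial V K)}
    (h : ((rs.length : WithTop ℕ) : WithBot (WithTop ℕ)) =
      ringKrullDim (MvPolynomial V K ⧸ edgeIdeal K G)) : M.card ≤ rs.length := by
  have h1 := card_le_ringKrullDim (K := K) G hM
  rw [← h] at h1
  have h2 : (M.card : ℕ∞) ≤ (rs.length : ℕ∞) := WithBot.coe_le_coe.mp h1
  exact_mod_cast h2

/-- Every cocycle of low degree over `K[G]`, on the variables outside `S`, agrees with a coboundary
in all squarefree multidegrees supported on independent sets. -/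
lemma exists_coboundary [Fintype V] {G : SimpleGraph V}
    (hCM : IsCohenMacaulayQuot K (edgeIdeal K G)) {S M : Finset V} (hM : indepCpx G M) (i : ℕ)
    (hi : i + S.card < M.card) (c : List V → MvPolynomial V K)
    (hc : ∀ l, (∀ v ∈ l, v ∉ S) → l.length = i + 1 → kd (X : V → MvPolynomial V K) c l ∈ edgeIdeal K G) :
    ∃ b : List V → MvPolynomial V K, ∀ l, (∀ v ∈ l, v ∉ S) → l.length = i →
      ∀ F : Finset V, indepCpx G F → coeff (sqf F) (c l) = coeff (sqf F) (kd (X : V → MvPolynomial V K) b l) := by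
  classical
  obtain ⟨rs, hrs, hreg, hlen⟩ := hCM
  let y : V → MvPolynomial V K := fun v => if v ∈ S then X v ^ 2 else X v
  have hex := kExact_of_isWeaklyRegular y rs (fun r hr => by
    refine (Ideal.span_le.mpr ?_ : Ideal.span _ ≤ _) (hrs r hr)
    rintro _ ⟨v, rfl⟩
    by_cases hv : v ∈ S
    · exact ⟨2, Ideal.subset_span ⟨v, by simp [y, hv]⟩⟩
    · exact ⟨1, Ideal.subset_span ⟨v, by simp [y, hv]⟩⟩) _ hreg.toIsWeaklyRegular
    (i + S.card) (lt_of_lt_of_le hi (card_le_length hM hlen))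
  let π : MvPolynomial V K →ₗ[MvPolynomial V K] (MvPolynomial V K ⧸ edgeIdeal K G) :=
    Submodule.mkQ _
  have hyX : ∀ (b : List V → MvPolynomial V K) l, (∀ v ∈ l, v ∉ S) → kd y b l = kd X b l :=
    fun b l hl => kd_congr hl (fun v hv => if_neg hv) fun _ _ _ => rfl
  obtain ⟨b', hb'⟩ := (RelExact.eraseFinset S i hex) (fun t => π (c t)) (by
    intro l hl hlen
    rw [kd_map, hyX _ _ hl]
    exact (Submodule.Quotient.mk_eq_zero _).mpr (hc l hl hlen))
  choose b hb using fun t => Submodule.mkQ_surjective _ (b' t)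
  refine ⟨b, fun l hl hlen F hF => ?_⟩
  have h1 := hb' l hl hlen
  have h2 : kd y b' l = π (kd (X : V → MvPolynomial V K) b l) := by
    rw [← hyX _ _ hl, ← kd_map]
    congr 1
    exact (funext hb).symm
  rw [h2, ← map_sub] at h1
  have h3 : Submodule.map π (Ideal.span (y '' (S : Set V))) =
      Ideal.span (y '' (S : Set V)) • ⊤ := by
    have := Submodule.map_smul'' (Ideal.span (y '' (S : Set V)))
      (⊤ : Submodule (MvPolynomial V K) (MvPolynomial V K)) π
    rwa [smul_eq_mul, Ideal.mul_top, Submodule.map_top,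
      LinearMap.range_eq_top.mpr (Submodule.mkQ_surjective _)] at this
  rw [← h3] at h1
  obtain ⟨q, hq, hqe⟩ := h1
  rw [← sub_eq_zero, ← map_sub] at hqe
  have h4 : q - (c l - kd (X : V → MvPolynomial V K) b l) ∈ edgeIdeal K G :=
    (Submodule.Quotient.mk_eq_zero _).mp hqe
  have e1 : coeff (sqf F) q = 0 := by
    refine coeff_eq_zero_of_mem_span ?_ hq
    rintro _ ⟨v, hv, rfl⟩ e' he'
    have := he' v
    rw [sqf_apply] at this
    simp only [y, if_pos (Finset.mem_coe.mp hv)]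
    rw [coeff_X_pow, if_neg]
    rintro rfl
    rw [Finsupp.single_eq_same] at this
    split_ifs at this <;> omega
  have e2 : coeff (sqf F) (q - (c l - kd (X : V → MvPolynomial V K) b l)) = 0 := by
    refine coeff_eq_zero_of_mem_span ?_ h4
    rintro _ ⟨v, w, h, rfl⟩ e' he'
    rw [X_mul_X_eq, coeff_monomial, if_neg]
    rintro rfl
    have hv := he' v
    have hw := he' w
    have hne := h.ne
    have hF' := hF v
    simp only [sqf_apply, Finsupp.add_apply, Finsupp.single_eq_same] at hv hw
    by_cases h1 : v ∈ F
    · by_cases h2 : w ∈ F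
      · exact hF v h1 w h2 h
      · simp [h2] at hw
    · simp [h1] at hv
  rw [coeff_sub, e1, coeff_sub] at e2
  exact (sub_eq_zero.mp (by simpa using e2)).symm

lemma sqf_insert [DecidableEq V] {S : Finset V} {v : V} (hv : v ∉ S) :
    sqf (insert v S) = sqf S + Finsupp.single v 1 := by
  rw [sqf, Finset.sum_insert hv, add_comm, sqf]

lemma indepCpx_insert [DecidableEq V] {G : SimpleGraph V} {S : Finset V} {v : V}
    (hS : indepCpx G S) (hv : ∀ s ∈ S, ¬ G.Adj s v) : indepCpx G (insert v S) := by
  intro a ha b hb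
  rw [Finset.mem_insert] at ha hb
  rcases ha with rfl | ha <;> rcases hb with rfl | hb
  · exact G.loopless.irrefl _
  · exact fun h => hv b hb h.symm
  · exact hv a ha
  · exact hS a ha b hb

lemma exists_inLink [Fintype V] {G : SimpleGraph V}
    (hCM : IsCohenMacaulayQuot K (edgeIdeal K G)) {S M : Finset V} (hS : indepCpx G S)
    (hM : indepCpx G M) (hi : S.card < M.card) : ∃ v, InLink G S v := by
  classical
  by_contra! hno
  obtain ⟨b, hb⟩ := exists_coboundary hCM hM 0 (by simpa using hi)
    (fun _ => monomial (sqf S) 1) (by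
      intro l hl hlen
      obtain ⟨v, rfl⟩ := List.length_eq_one_iff.mp hlen
      have hv : v ∉ S := hl v (by simp)
      have := hno v
      simp only [InLink, not_and, not_forall, not_not] at this
      obtain ⟨s, hs, hsv⟩ := this hv
      simp only [kd_cons, kd_nil, sub_zero, smul_eq_mul, X, monomial_mul]
      refine monomial_mem_edgeIdeal hsv ?_ ?_ _ <;> simp [sqf_apply, hs])
  have := hb [] (by simp) rfl S hS
  simp [kd_nil] at this

/-- Zeroth reduced cohomology of links vanishes in low degree. -/
lemma const_of_link [Fintype V] {G : SimpleGraph V}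
    (hCM : IsCohenMacaulayQuot K (edgeIdeal K G)) {S M : Finset V} (hS : indepCpx G S)
    (hM : indepCpx G M) (hi : S.card + 1 < M.card) (f : V → K)
    (hf : ∀ t u, InLink G S t → InLink G S u → ¬ G.Adj t u → f t = f u) :
    ∃ k, ∀ t, InLink G S t → f t = k := by
  classical
  let c : List V → MvPolynomial V K
    | [t] => monomial (sqf S + Finsupp.single t 1) (f t)
    | _ => 0
  obtain ⟨b, hb⟩ := exists_coboundary (S := S) hCM hM 1 (by omega) c (by
      intro l hl hlen
      obtain ⟨t, u, rfl⟩ := List.length_eq_two.mp hlen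
      have ht : t ∉ S := hl t (by simp)
      have hu : u ∉ S := hl u (by simp)
      let e := sqf S + Finsupp.single t 1 + Finsupp.single u 1
      have e1 : kd (X : V → MvPolynomial V K) c [t, u] = monomial e (f u - f t) := by
        simp only [kd_cons, kd_nil, sub_zero, smul_eq_mul, X, c, monomial_mul, one_mul]
        rw [map_sub]
        congr 2 <;> simp only [e] <;> ac_rfl
      rw [e1]
      by_cases hadj : ∃ a b, G.Adj a b ∧ 1 ≤ e a ∧ 1 ≤ e b
      · obtain ⟨a, b, h, ha, hb⟩ := hadj
        exact monomial_mem_edgeIdeal h ha hb _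
      · push Not at hadj
        have key : ∀ a b, (a ∈ S ∨ a = t ∨ a = u) → (b ∈ S ∨ b = t ∨ b = u) → ¬ G.Adj a b := by
          intro a b ha hb h
          have := hadj a b h (by
            simp only [e, Finsupp.add_apply, sqf_apply]
            rcases ha with h | rfl | rfl <;> simp [*]; omega)
          simp only [e, Finsupp.add_apply, sqf_apply] at this
          rcases hb with h | rfl | rfl <;> simp [*] at this
        rw [hf t u ⟨ht, fun s hs => key _ _ (by simp [hs]) (by simp)⟩
          ⟨hu, fun s hs => key _ _ (by simp [hs]) (by simp)⟩ (key _ _ (by simp) (by simp))]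
        simp)
  refine ⟨coeff (sqf S) (b []), fun t ht => ?_⟩
  have := hb [t] (by simpa using ht.1) rfl _ (indepCpx_insert hS ht.2)
  rw [sqf_insert ht.1] at this
  simp only [c, kd_cons, kd_nil, sub_zero, smul_eq_mul] at this
  rw [add_comm (sqf S), coeff_X_mul, coeff_monomial, if_pos rfl] at this
  exact this

/-- First cohomology of links vanishes in low degree. -/
lemma primitive_of_link [Fintype V] {G : SimpleGraph V}
    (hCM : IsCohenMacaulayQuot K (edgeIdeal K G)) {S M : Finset V} (hS : indepCpx G S)
    (hM : indepCpx G M) (hi : S.card + 2 < M.card) (f : V → V → K)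
    (hf : ∀ t u w, InLink G S t → InLink G S u → InLink G S w →
      ¬ G.Adj t u → ¬ G.Adj t w → ¬ G.Adj u w → f u w - f t w + f t u = 0) :
    ∃ g : V → K, ∀ t u, InLink G S t → InLink G S u → t ≠ u → ¬ G.Adj t u →
      f t u = g u - g t := by
  classical
  let c : List V → MvPolynomial V K
    | [t, u] => monomial (sqf S + Finsupp.single t 1 + Finsupp.single u 1) (f t u)
    | _ => 0
  obtain ⟨b, hb⟩ := exists_coboundary (S := S) hCM hM 2 (by omega) c (by
      intro l hl hlen
      obtain ⟨t, u, w, rfl⟩ := List.length_eq_three.mp hlen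
      have ht : t ∉ S := hl t (by simp)
      have hu : u ∉ S := hl u (by simp)
      have hw : w ∉ S := hl w (by simp)
      let e := sqf S + Finsupp.single t 1 + Finsupp.single u 1 + Finsupp.single w 1
      have e1 : kd (X : V → MvPolynomial V K) c [t, u, w] = monomial e (f u w - f t w + f t u) := by
        simp only [kd_cons, kd_nil, sub_zero, smul_eq_mul, X, c, monomial_mul, one_mul]
        rw [map_add, map_sub, sub_sub_eq_add_sub, add_sub_right_comm]
        congr 3 <;> simp only [e] <;> ac_rfl
      rw [e1]
      by_cases hadj : ∃ a b, G.Adj a b ∧ 1 ≤ e a ∧ 1 ≤ e b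
      · obtain ⟨a, b, h, ha, hb⟩ := hadj
        exact monomial_mem_edgeIdeal h ha hb _
      · push Not at hadj
        have key : ∀ a b, (a ∈ S ∨ a = t ∨ a = u ∨ a = w) → (b ∈ S ∨ b = t ∨ b = u ∨ b = w) →
            ¬ G.Adj a b := by
          intro a b ha hb h
          have := hadj a b h (by
            simp only [e, Finsupp.add_apply, sqf_apply]
            rcases ha with h | rfl | rfl | rfl <;> simp [*] <;> omega)
          simp only [e, Finsupp.add_apply, sqf_apply] at this
          rcases hb with h | rfl | rfl | rfl <;> simp [*] at this
        rw [hf t u w ⟨ht, fun s hs => key _ _ (by simp [hs]) (by simp)⟩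
          ⟨hu, fun s hs => key _ _ (by simp [hs]) (by simp)⟩
          ⟨hw, fun s hs => key _ _ (by simp [hs]) (by simp)⟩ (key _ _ (by simp) (by simp))
          (key _ _ (by simp) (by simp)) (key _ _ (by simp) (by simp))]
        simp)
  refine ⟨fun u => coeff (sqf S + Finsupp.single u 1) (b [u]), fun t u ht hu hne hadj => ?_⟩
  have h1 : u ∉ insert t S := by simp [hne.symm, hu.1]
  have := hb [t, u] (by simpa using ⟨ht.1, hu.1⟩) rfl _ (indepCpx_insert (v := u)
    (indepCpx_insert hS ht.2) (by simpa [hadj] using hu.2))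
  rw [sqf_insert h1, sqf_insert ht.1] at this
  simp only [c, kd_cons, kd_nil, sub_zero, smul_eq_mul] at this
  have e1 : coeff (sqf S + Finsupp.single t 1 + Finsupp.single u 1) (X t * b [u]) =
      coeff (sqf S + Finsupp.single u 1) (b [u]) := by
    rw [add_right_comm, add_comm _ (Finsupp.single t 1), coeff_X_mul]
  have e2 : coeff (sqf S + Finsupp.single t 1 + Finsupp.single u 1) (X u * b [t]) =
      coeff (sqf S + Finsupp.single t 1) (b [t]) := by
    rw [add_comm _ (Finsupp.single u 1), coeff_X_mul]
  rw [coeff_sub, coeff_monomial, if_pos rfl, e1, e2] at this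
  exact this

end EdgeIdeal

section Links
variable {K} {V : Type}

lemma indepCpx.subset {G : SimpleGraph V} {S T : Finset V} (hT : indepCpx G T) (h : S ⊆ T) :
    indepCpx G S := fun a ha b hb => hT a (h ha) b (h hb)

lemma link_ne_fourCycle [Fintype V] {G : SimpleGraph V}
    (hCM : IsCohenMacaulayQuot K (edgeIdeal K G)) {S : Finset V} (hS : indepCpx G S)
    (a b c d : V) (hac : ¬ G.Adj a c) (hne : a ≠ c) (hab : G.Adj a b) (hbc : G.Adj b c)
    (hcd : G.Adj c d) (hda : G.Adj d a)
    (hL : ∀ v, InLink G S v ↔ v = a ∨ v = b ∨ v = c ∨ v = d) : False := by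
  classical
  have ha := (hL a).2 (by simp)
  have hc := (hL c).2 (by simp)
  have hM := indepCpx_insert (v := c) (indepCpx_insert hS ha.2) (by simpa [hac] using hc.2)
  obtain ⟨k, hk⟩ := const_of_link hCM hS hM (by
    rw [Finset.card_insert_of_notMem (by simp [hne.symm, hc.1]),
      Finset.card_insert_of_notMem ha.1]; omega) (fun v => if v = a ∨ v = c then 1 else 0) (by
    intro t u ht hu htu
    rw [hL] at ht hu
    have := hab.ne
    have := hbc.ne
    have := hcd.ne
    have := hda.ne
    have := hab.ne'
    have := hbc.ne'
    have := hcd.ne'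
    have := hda.ne'
    have := hab.symm
    have := hbc.symm
    have := hcd.symm
    have := hda.symm
    rcases ht with rfl | rfl | rfl | rfl <;> rcases hu with rfl | rfl | rfl | rfl <;>
      simp_all)
  have h1 := hk a ha
  have h2 := hk b ((hL b).2 (by simp))
  simp only [true_or, if_true] at h1
  rw [if_neg (by simp [hab.ne', hbc.ne])] at h2
  exact one_ne_zero (h1.trans h2.symm)

/-- The number of signed crossings of the step `6 → 0` along a short step from `k` to `l`. -/
def crossing (k l : Fin 7) : ℤ :=
  if l - k = 1 ∨ l - k = 2 then (if l < k then 1 else 0)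
  else if k - l = 1 ∨ k - l = 2 then (if k < l then -1 else 0) else 0

lemma crossing_cocycle : ∀ k l m : Fin 7, ¬ (l - k = 3 ∨ k - l = 3) → ¬ (m - k = 3 ∨ k - m = 3) →
    ¬ (m - l = 3 ∨ l - m = 3) → crossing l m - crossing k m + crossing k l = 0 := by
  decide

lemma link_ne_sevenCycle [Fintype V] {G : SimpleGraph V}
    (hCM : IsCohenMacaulayQuot K (edgeIdeal K G)) {S : Finset V} (hS : indepCpx G S)
    (p : Fin 7 → V) (hp : Function.Injective p)
    (hadj : ∀ i j, G.Adj (p i) (p j) ↔ j - i = 3 ∨ i - j = 3)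
    (hL : ∀ v, InLink G S v ↔ ∃ i, v = p i) : False := by
  classical
  have hl : ∀ i, InLink G S (p i) := fun i => (hL _).2 ⟨i, rfl⟩
  have hM : indepCpx G (insert (p 2) (insert (p 1) (insert (p 0) S))) := by
    refine indepCpx_insert (indepCpx_insert (indepCpx_insert hS (hl 0).2) ?_) ?_
    · have := (hl 1).2
      have h0 : ¬ G.Adj (p 0) (p 1) := by rw [hadj]; decide
      simpa [h0] using this
    · have := (hl 2).2
      have h0 : ¬ G.Adj (p 0) (p 2) := by rw [hadj]; decide
      have h1 : ¬ G.Adj (p 1) (p 2) := by rw [hadj]; decide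
      simpa [h0, h1] using this
  have hcard : S.card + 2 < (insert (p 2) (insert (p 1) (insert (p 0) S))).card := by
    rw [Finset.card_insert_of_notMem (by simp [hp.eq_iff, (hl 2).1]),
      Finset.card_insert_of_notMem (by simp [hp.eq_iff, (hl 1).1]),
      Finset.card_insert_of_notMem (hl 0).1]
    omega
  have hinv : ∀ i, Function.invFun p (p i) = i := Function.leftInverse_invFun hp
  obtain ⟨g, hg⟩ := primitive_of_link hCM hS hM hcard
    (fun t u => (crossing (Function.invFun p t) (Function.invFun p u) : K)) (by
      intro t u w ht hu hw htu htw huw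
      obtain ⟨i, rfl⟩ := (hL _).1 ht
      obtain ⟨j, rfl⟩ := (hL _).1 hu
      obtain ⟨k, rfl⟩ := (hL _).1 hw
      rw [hadj] at htu htw huw
      simp only [hinv]
      exact_mod_cast congrArg (Int.cast : ℤ → K) (crossing_cocycle i j k htu htw huw))
  have step : ∀ i, ((crossing i (i + 1) : ℤ) : K) = g (p (i + 1)) - g (p i) := by
    intro i
    have := hg (p i) (p (i + 1)) (hl _) (hl _) (by rw [hp.ne_iff]; revert i; decide)
      (by rw [hadj]; revert i; decide)
    simpa only [hinv] using this
  have hsum : ∑ i : Fin 7, ((crossing i (i + 1) : ℤ) : K) = 0 := by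
    simp only [step, Finset.sum_sub_distrib]
    rw [sub_eq_zero]
    exact Fintype.sum_equiv (Equiv.addRight 1) _ _ fun _ => rfl
  rw [← Int.cast_sum, show ∑ i : Fin 7, crossing i (i + 1) = 1 by decide] at hsum
  simp at hsum

end Links

section Cactus
variable {V : Type}

/-- `a` and `b` are joined by a walk of `G` avoiding `x`. -/
def ConnAvoiding (G : SimpleGraph V) (x a b : V) : Prop := ∃ p : G.Walk a b, x ∉ p.support

lemma exists_cycleSubgraph {G : SimpleGraph V} {x y u : V} (hy : G.Adj x y) (hu : G.Adj x u)
    (hne : u ≠ y) (h : ConnAvoiding G x u y) :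
    ∃ C : G.Subgraph, IsCycleSubgraph G C ∧ C.Adj x y ∧ C.Adj x u := by
  classical
  obtain ⟨p, hp⟩ := h
  have hq : x ∉ p.bypass.support := fun h => hp (p.support_bypass_subset_support h)
  have hcyc : (SimpleGraph.Walk.cons hu (p.bypass.concat hy.symm)).IsCycle := by
    rw [SimpleGraph.Walk.cons_isCycle_iff]
    refine ⟨p.bypass_isPath.concat hq _, ?_⟩
    rw [SimpleGraph.Walk.edges_concat, List.concat_eq_append, List.mem_append, not_or]
    refine ⟨fun h => hq (SimpleGraph.Walk.fst_mem_support_of_mem_edges _ h), ?_⟩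
    simp only [List.mem_singleton, Sym2.eq_iff, not_or, not_and]
    exact ⟨fun h => absurd h hy.ne, fun _ => hne⟩
  refine ⟨_, ⟨SimpleGraph.Walk.toSubgraph_connected _, fun v hv =>
    hcyc.ncard_neighborSet_toSubgraph_eq_two ((SimpleGraph.Walk.mem_verts_toSubgraph _).1 hv)⟩, ?_, ?_⟩
  · rw [SimpleGraph.Walk.adj_toSubgraph_iff_mem_edges]
    simp [SimpleGraph.Walk.edges_concat]
  · rw [SimpleGraph.Walk.adj_toSubgraph_iff_mem_edges]
    simp [SimpleGraph.Walk.edges_concat]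

lemma IsCactus.not_connAvoiding {G : SimpleGraph V} (hG : IsCactus G) {x y u w : V}
    (hy : G.Adj x y) (hu : G.Adj x u) (hw : G.Adj x w) (hyu : u ≠ y) (hyw : w ≠ y) (huw : u ≠ w)
    (h1 : ConnAvoiding G x u y) : ¬ ConnAvoiding G x w y := by
  intro h2
  obtain ⟨C, hC, hCy, hCu⟩ := exists_cycleSubgraph hy hu hyu h1
  obtain ⟨D, hD, hDy, hDw⟩ := exists_cycleSubgraph hy hw hyw h2
  obtain rfl := hG C D hC hD s(x, y) hCy hDy
  have h3 := hC.2 x (C.edge_vert hCy)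
  obtain ⟨a, b, -, hab⟩ := Set.ncard_eq_two.mp h3
  have m1 : y ∈ C.neighborSet x := hCy
  have m2 : u ∈ C.neighborSet x := hCu
  have m3 : w ∈ C.neighborSet x := hDw
  rw [hab] at m1 m2 m3
  simp only [Set.mem_insert_iff, Set.mem_singleton_iff] at m1 m2 m3
  grind

lemma ConnAvoiding.symm {G : SimpleGraph V} {x a b : V} (h : ConnAvoiding G x a b) :
    ConnAvoiding G x b a := by
  obtain ⟨p, hp⟩ := h
  exact ⟨p.reverse, by simpa using hp⟩

lemma ConnAvoiding.trans {G : SimpleGraph V} {x a b c : V} (h : ConnAvoiding G x a b)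
    (h' : ConnAvoiding G x b c) : ConnAvoiding G x a c := by
  obtain ⟨p, hp⟩ := h
  obtain ⟨q, hq⟩ := h'
  exact ⟨p.append q, by simp [SimpleGraph.Walk.mem_support_append_iff, hp, hq]⟩

lemma ConnAvoiding.of_adj {G : SimpleGraph V} {x a b : V} (h : G.Adj a b) (ha : x ≠ a)
    (hb : x ≠ b) : ConnAvoiding G x a b :=
  ⟨h.toWalk, by simp [ha, hb]⟩

lemma ConnAvoiding.refl {G : SimpleGraph V} {x a : V} (ha : x ≠ a) : ConnAvoiding G x a a :=
  ⟨.nil, by simp [ha]⟩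

lemma ConnAvoiding.ne_left {G : SimpleGraph V} {x a b : V} (h : ConnAvoiding G x a b) : x ≠ a := by
  obtain ⟨p, hp⟩ := h
  rintro rfl
  simp at hp

lemma ConnAvoiding.ne_right {G : SimpleGraph V} {x a b : V} (h : ConnAvoiding G x a b) :
    x ≠ b := h.symm.ne_left

end Cactus

section Decomposition
variable {V : Type}

/-- The combinatorial consequences of the Cohen–Macaulay and the cactus property from which the
structure of `G` is derived. -/
structure Tame (G : SimpleGraph V) (α : ℕ) : Prop where
  card_le : ∀ S, indepCpx G S → S.card ≤ α
  exists_extend : ∀ S, indepCpx G S → ∃ M, S ⊆ M ∧ indepCpx G M ∧ M.card = α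
  not_four : ∀ S, indepCpx G S → ∀ a b c d, ¬ G.Adj a c → a ≠ c → G.Adj a b → G.Adj b c →
    G.Adj c d → G.Adj d a → ¬ ∀ v, InLink G S v ↔ v = a ∨ v = b ∨ v = c ∨ v = d
  not_seven : ∀ S, indepCpx G S → ∀ p : Fin 7 → V, Function.Injective p →
    (∀ i j, G.Adj (p i) (p j) ↔ j - i = 3 ∨ i - j = 3) → ¬ ∀ v, InLink G S v ↔ ∃ i, v = p i
  not_conn : ∀ x y u w, G.Adj x y → G.Adj x u → G.Adj x w → u ≠ y → w ≠ y → u ≠ w →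
    ConnAvoiding G x u y → ¬ ConnAvoiding G x w y

lemma exists_tame [Fintype V] {K : Type} [Field K] {G : SimpleGraph V} (hG : IsCactus G)
    (hCM : IsCohenMacaulayQuot K (edgeIdeal K G)) : ∃ α, Tame G α := by
  classical
  let I : Finset (Finset V) := Finset.univ.filter fun S => indepCpx G S
  have hI : I.Nonempty := ⟨∅, Finset.mem_filter.mpr ⟨Finset.mem_univ _, fun v hv => by simp at hv⟩⟩
  obtain ⟨M₀, hM₀, hmax⟩ := Finset.exists_max_image I Finset.card hI
  have hM₀' : indepCpx G M₀ := (Finset.mem_filter.mp hM₀).2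
  refine ⟨M₀.card, fun S hS => hmax S (by simp [I, hS]), fun S hS => ?_,
    fun S hS a b c d h1 h2 h3 h4 h5 h6 h7 => link_ne_fourCycle hCM hS a b c d h1 h2 h3 h4 h5 h6 h7,
    fun S hS p hp h1 h2 => link_ne_sevenCycle hCM hS p hp h1 h2,
    fun x y u w h1 h2 h3 h4 h5 h6 h7 => hG.not_connAvoiding h1 h2 h3 h4 h5 h6 h7⟩
  obtain ⟨M, hM, hMmax⟩ := Finset.exists_max_image (I.filter fun M => S ⊆ M) Finset.card
    ⟨S, by simp [I, hS]⟩
  simp only [I, Finset.mem_filter, Finset.mem_univ, true_and, and_imp] at hM hMmax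
  refine ⟨M, hM.2, hM.1, le_antisymm (hmax M (by simp [I, hM.1])) ?_⟩
  by_contra! hlt
  obtain ⟨v, hv⟩ := exists_inLink hCM hM.1 hM₀' hlt
  have := hMmax _ (indepCpx_insert hM.1 hv.2) (hM.2.trans (Finset.subset_insert _ _))
  rw [Finset.card_insert_of_notMem hv.1] at this
  omega

/-- The subgraph of `G` on the vertices outside the closed neighbourhood of `S`. -/
def linkGraph (G : SimpleGraph V) (S : Finset V) : SimpleGraph V where
  Adj a b := G.Adj a b ∧ InLink G S a ∧ InLink G S b
  symm := ⟨fun _ _ h => ⟨h.1.symm, h.2.2, h.2.1⟩⟩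
  loopless := ⟨fun _ h => G.loopless.irrefl _ h.1⟩

lemma linkGraph_le (G : SimpleGraph V) (S : Finset V) : linkGraph G S ≤ G := fun _ _ h => h.1

lemma ConnAvoiding.mono {G H : SimpleGraph V} (hle : H ≤ G) {x a b : V}
    (h : ConnAvoiding H x a b) : ConnAvoiding G x a b := by
  obtain ⟨p, hp⟩ := h
  exact ⟨p.mapLe hle, by simpa using hp⟩

lemma Tame.not_conn_linkGraph {G : SimpleGraph V} {α : ℕ} (hG : Tame G α) {S : Finset V}
    {x y u w : V} (hy : (linkGraph G S).Adj x y) (hu : (linkGraph G S).Adj x u)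
    (hw : (linkGraph G S).Adj x w) (h1 : ConnAvoiding (linkGraph G S) x u y)
    (h2 : ConnAvoiding (linkGraph G S) x w y) : u = y ∨ w = y ∨ u = w := by
  by_contra! h
  exact hG.not_conn x y u w hy.1 hu.1 hw.1 h.1 h.2.1 h.2.2 (h1.mono (linkGraph_le _ _))
    (h2.mono (linkGraph_le _ _))

lemma exists_first_hit {H : SimpleGraph V} {x w : V} (p : H.Walk w x) (hw : x ≠ w) :
    ∃ y ∈ p.support, H.Adj x y ∧ ConnAvoiding H x w y := by
  induction p with
  | nil => exact absurd rfl hw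
  | @cons a b c h p ih =>
    by_cases hb : c = b
    · subst hb
      exact ⟨a, by simp, h.symm, .refl hw⟩
    · obtain ⟨y, hy, hadj, hc⟩ := ih hb
      exact ⟨y, by simp [hy], hadj, (ConnAvoiding.of_adj h hw hb).trans hc⟩

/-- If every vertex of `linkGraph G S` has at least two neighbours, then it contains a cycle all
of whose vertices but one have exactly two neighbours. -/
lemma Tame.exists_end_cycle [Fintype V] {G : SimpleGraph V} {α : ℕ} (hG : Tame G α) {S : Finset V}
    (hne : ∃ v, InLink G S v)
    (hdeg : ∀ v, InLink G S v → ∀ a, ∃ b, b ≠ a ∧ (linkGraph G S).Adj v b) :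
    ∃ (D : Set V) (x y z : V), y ∈ D ∧ z ∈ D ∧ y ≠ z ∧ x ∉ D ∧
      (∀ v ∈ D, (linkGraph G S).Adj x v ↔ v = y ∨ v = z) ∧
      (∀ e ∈ D, ∀ v, (linkGraph G S).Adj e v → v ∈ D ∨ v = x) ∧
      (∀ e ∈ D, ∀ a, (linkGraph G S).Adj e a →
        ∃ b ≠ a, ∀ v, (linkGraph G S).Adj e v ↔ v = a ∨ v = b) := by
  classical
  set H := linkGraph G S with hH
  let T : Finset (V × V) := Finset.univ.filter fun q =>
    InLink G S q.1 ∧ InLink G S q.2 ∧ q.1 ≠ q.2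
  let comp : V × V → Finset V := fun q => Finset.univ.filter fun v => ConnAvoiding H q.1 q.2 v
  obtain ⟨⟨x, v₀⟩, hmem, hmin⟩ := Finset.exists_min_image T (fun q => (comp q).card) (by
    obtain ⟨v, hv⟩ := hne
    obtain ⟨b, -, hb⟩ := hdeg v hv v
    exact ⟨(v, b), by simp [T, hv, hb.2.2, hb.ne]⟩)
  simp only [T, Finset.mem_filter, Finset.mem_univ, true_and] at hmem
  obtain ⟨hx, hv₀, hxv₀⟩ := hmem
  let D : Set V := {v | ConnAvoiding H x v₀ v}
  have hv₀D : v₀ ∈ D := .refl hxv₀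
  have hxD : ∀ e ∈ D, x ≠ e := fun e he => ConnAvoiding.ne_right he
  have hnb : ∀ e ∈ D, ∀ v, H.Adj e v → v ∈ D ∨ v = x := by
    intro e he v hv
    by_cases h : v = x
    · exact .inr h
    · exact .inl (he.trans (.of_adj hv (hxD e he) (Ne.symm h)))
  have hDW : ∀ e ∈ D, InLink G S e := by
    intro e he
    by_cases h : v₀ = e
    · exact h ▸ hv₀
    · obtain ⟨p, -⟩ := he
      obtain ⟨y, -, hy, -⟩ := exists_first_hit p (Ne.symm h)
      exact hy.2.1
  have key : ∀ e ∈ D, ∀ v ∈ D, v ≠ e → ConnAvoiding H e v x := by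
    intro e he v hv hve
    by_contra hcon
    have h1 := hmin (e, v) (by simp [T, hDW e he, hDW v hv, hve.symm])
    have h2 : comp (e, v) ⊂ comp (x, v₀) := by
      rw [Finset.ssubset_iff_of_subset]
      · exact ⟨e, by simpa [comp] using (show ConnAvoiding H x v₀ e from he), by
          simp only [comp, Finset.mem_filter, Finset.mem_univ, true_and]
          exact fun h => h.ne_right rfl⟩
      · intro w hw
        simp only [comp, Finset.mem_filter, Finset.mem_univ, true_and] at hw ⊢
        obtain ⟨p, hp⟩ := hw
        refine ConnAvoiding.trans hv ⟨p, fun hxp => hcon ⟨p.takeUntil x hxp, fun h => ?_⟩⟩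
        exact hp (p.support_takeUntil_subset_support hxp h)
    exact absurd (Finset.card_lt_card h2) (not_lt.mpr h1)
  have hconn : ∀ e ∈ D, ∀ v, H.Adj e v → ConnAvoiding H e v x := by
    intro e he v hv
    rcases hnb e he v hv with h | rfl
    · exact key e he v h hv.ne'
    · exact .refl (hxD e he).symm
  have htwo : ∀ e ∈ D, ∀ a, H.Adj e a → ∃ b ≠ a, ∀ v, H.Adj e v ↔ v = a ∨ v = b := by
    intro e he a ha
    obtain ⟨b, hba, hb⟩ := hdeg e (hDW e he) a
    refine ⟨b, hba, fun v => ⟨fun hv => ?_, ?_⟩⟩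
    · have := hG.not_conn_linkGraph ha hb hv ((hconn e he b hb).trans (hconn e he a ha).symm)
        ((hconn e he v hv).trans (hconn e he a ha).symm)
      tauto
    · rintro (rfl | rfl) <;> assumption
  obtain ⟨b, hbx, hb⟩ := hdeg v₀ hv₀ x
  have hbD : b ∈ D := (hnb _ hv₀D _ hb).resolve_right hbx
  obtain ⟨p, -⟩ := key v₀ hv₀D b hbD hb.ne'
  obtain ⟨y, -, hxy, hby⟩ := exists_first_hit p (hxD b hbD)
  have hyD : y ∈ D := ConnAvoiding.trans hbD hby
  obtain ⟨c, hcx, hc⟩ := hdeg y (hDW y hyD) x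
  have hcD : c ∈ D := (hnb _ hyD _ hc).resolve_right hcx
  obtain ⟨q, hq⟩ := key y hyD c hcD hc.ne'
  obtain ⟨z, hz, hxz, hcz⟩ := exists_first_hit q (hxD c hcD)
  have hzD : z ∈ D := ConnAvoiding.trans hcD hcz
  have hzy : z ≠ y := fun h => hq (h ▸ hz)
  refine ⟨D, x, y, z, hyD, hzD, hzy.symm, fun h => hxD x h rfl, fun v hv => ⟨fun h => ?_, ?_⟩,
    hnb, htwo⟩
  · have := hG.not_conn_linkGraph hxy hxz h (hzD.symm.trans hyD) (ConnAvoiding.trans hv.symm hyD)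
    tauto
  · rintro (rfl | rfl) <;> assumption

end Decomposition

section Blocks
variable {V : Type}

lemma Tame.card_eq_of_maximal {G : SimpleGraph V} {α : ℕ} (hG : Tame G α) {M : Finset V}
    (hM : indepCpx G M) (hmax : ∀ v, ¬ InLink G M v) : M.card = α := by
  obtain ⟨N, hMN, hN, hcard⟩ := hG.exists_extend M hM
  have : M = N := Finset.Subset.antisymm hMN fun v hv => by
    by_contra hvM
    exact hmax v ⟨hvM, fun s hs => hN s (hMN hs) v hv⟩
  rw [this, hcard]

lemma Tame.not_inLink {G : SimpleGraph V} {α : ℕ} (hG : Tame G α) {M : Finset V}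
    (hM : indepCpx G M) (hcard : M.card = α) (v : V) : ¬ InLink G M v := by
  classical
  intro hv
  have := hG.card_le _ (indepCpx_insert hM hv.2)
  rw [Finset.card_insert_of_notMem hv.1] at this
  omega

lemma Tame.not_swap {G : SimpleGraph V} {α : ℕ} (hG : Tame G α) {S T : Finset V} (hST : S ⊆ T)
    (hT : indepCpx G T) {a b c : V} (hb : b ∈ T) (hab : (linkGraph G S).Adj b a)
    (hbc : (linkGraph G S).Adj b c) (hac : ¬ G.Adj a c) (hne : a ≠ c)
    (ha : ∀ v, (linkGraph G S).Adj a v → v = b ∨ ∃ t ∈ T, G.Adj t v)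
    (hc : ∀ v, (linkGraph G S).Adj c v → v = b ∨ ∃ t ∈ T, G.Adj t v) : False := by
  classical
  obtain ⟨M, hTM, hM, hcard⟩ := hG.exists_extend T hT
  have aux : ∀ d, InLink G S d → (∀ v, (linkGraph G S).Adj d v → v = b ∨ ∃ t ∈ T, G.Adj t v) →
      ∀ v ∈ M.erase b, ¬ G.Adj v d := by
    intro d hd hd' v hv hvd
    rw [Finset.mem_erase] at hv
    by_cases hvW : InLink G S v
    · rcases hd' v ⟨hvd.symm, hd, hvW⟩ with h | ⟨t, ht, htv⟩
      · exact hv.1 h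
      · exact hM t (hTM ht) v hv.2 htv
    · by_cases hvS : v ∈ S
      · exact hd.2 v hvS hvd
      · simp only [InLink, hvS, not_false_eq_true, true_and, not_forall, not_not] at hvW
        obtain ⟨s, hs, hsv⟩ := hvW
        exact hM s (hTM (hST hs)) v hv.2 hsv
  have haM : a ∉ M := fun h => hM b (hTM hb) a h hab.1
  have hcM : c ∉ M := fun h => hM b (hTM hb) c h hbc.1
  have hI : indepCpx G (insert c (insert a (M.erase b))) := by
    refine indepCpx_insert (indepCpx_insert (hM.subset (Finset.erase_subset _ _))
      (aux a hab.2.2 ha)) fun s hs => ?_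
    rcases Finset.mem_insert.mp hs with rfl | hs
    · exact hac
    · exact aux c hbc.2.2 hc s hs
  have := hG.card_le _ hI
  rw [Finset.card_insert_of_notMem (by simp [hne.symm, hcM]),
    Finset.card_insert_of_notMem (by simp [haM]), Finset.card_erase_of_mem (hTM hb)] at this
  have := Finset.card_pos.mpr ⟨b, hTM hb⟩
  omega

/-- A union of components of the link of `S` is again a link. -/
lemma Tame.exists_link_eq {G : SimpleGraph V} {α : ℕ} (hG : Tame G α) {S : Finset V}
    (hS : indepCpx G S) (C : V → Prop) (hC : ∀ v, C v → InLink G S v)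
    (hcl : ∀ v w, C v → (linkGraph G S).Adj v w → C w) :
    ∃ S', indepCpx G S' ∧ ∀ v, InLink G S' v ↔ C v := by
  classical
  obtain ⟨M, hSM, hM, hcard⟩ := hG.exists_extend S hS
  refine ⟨M.filter fun v => ¬ C v, hM.subset (Finset.filter_subset _ _), fun v => ⟨fun hv => ?_,
    fun hv => ⟨by simp [hv], fun s hs hsv => ?_⟩⟩⟩
  · by_contra hvC
    have hvM : v ∉ M := fun h => hv.1 (Finset.mem_filter.mpr ⟨h, hvC⟩)
    have := hG.not_inLink hM hcard v
    simp only [InLink, hvM, not_false_eq_true, true_and, not_forall, not_not] at this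
    obtain ⟨m, hm, hmv⟩ := this
    have hmC : C m := by
      by_contra h
      exact hv.2 m (Finset.mem_filter.mpr ⟨hm, h⟩) hmv
    refine hvC (hcl m v hmC ⟨hmv, hC m hmC, fun h => hvM (hSM h), fun s hs hsv => ?_⟩)
    exact hv.2 s (Finset.mem_filter.mpr ⟨hSM hs, fun h => (hC s h).1 hs⟩) hsv
  · rw [Finset.mem_filter] at hs
    by_cases hsS : InLink G S s
    · exact hs.2 (hcl v s hv ⟨hsv.symm, hC v hv, hsS⟩)
    · by_cases h : s ∈ S
      · exact (hC v hv).2 s h hsv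
      · simp only [InLink, h, not_false_eq_true, true_and, not_forall, not_not] at hsS
        obtain ⟨t, ht, hts⟩ := hsS
        exact hM t (hSM ht) s hs.1 hts

/-- `B` is a nonempty clique of `G`. -/
def IsCliqueBlock (G : SimpleGraph V) (B : Finset V) : Prop :=
  B.Nonempty ∧ ∀ a ∈ B, ∀ b ∈ B, a ≠ b → G.Adj a b

/-- `a, b, c, d, e` is an induced pentagon of `G`. -/
structure IsPentagon (G : SimpleGraph V) (a b c d e : V) : Prop where
  ab : G.Adj a b
  bc : G.Adj b c
  cd : G.Adj c d
  de : G.Adj d e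
  ea : G.Adj e a
  ac : ¬ G.Adj a c
  bd : ¬ G.Adj b d
  ce : ¬ G.Adj c e
  da : ¬ G.Adj d a
  eb : ¬ G.Adj e b

/-- `B` is the vertex set of an induced pentagon of `G`. -/
def IsPentagonBlock (G : SimpleGraph V) (B : Finset V) : Prop :=
  ∃ a b c d e, (∀ v, v ∈ B ↔ v = a ∨ v = b ∨ v = c ∨ v = d ∨ v = e) ∧ IsPentagon G a b c d e

open Classical in
/-- The independence number of a block. -/
noncomputable def blockWeight (G : SimpleGraph V) (B : Finset V) : ℕ :=
  if IsCliqueBlock G B then 1 else 2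

lemma IsPentagonBlock.not_isCliqueBlock {G : SimpleGraph V} {B : Finset V}
    (h : IsPentagonBlock G B) : ¬ IsCliqueBlock G B := by
  obtain ⟨a, b, c, d, e, hB, hp⟩ := h
  intro hc
  refine hp.ac (hc.2 a ((hB a).2 (by simp)) c ((hB c).2 (by simp)) ?_)
  rintro rfl
  exact hp.da hp.cd.symm

/-- The first block of a decomposition of the link of `S`. -/
structure IsEndBlock (G : SimpleGraph V) (S B S₀ : Finset V) : Prop where
  block : IsCliqueBlock G B ∨ IsPentagonBlock G B
  nonempty : B.Nonempty
  indep : indepCpx G S₀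
  subset : S₀ ⊆ B
  card : S₀.card = blockWeight G B
  inLink : ∀ b ∈ B, InLink G S b
  cover : ∀ b ∈ B, b ∈ S₀ ∨ ∃ s ∈ S₀, G.Adj s b
  nbr : ∀ s ∈ S₀, ∀ v, (linkGraph G S).Adj s v → v ∈ B

lemma exists_isEndBlock_of_leaf {G : SimpleGraph V} {S : Finset V} {v a : V} (hv : InLink G S v)
    (h : ∀ b, (linkGraph G S).Adj v b → b = a) : ∃ B S₀, IsEndBlock G S B S₀ := by
  classical
  have mk : ∀ B : Finset V, v ∈ B → (∀ b ∈ B, b = v ∨ (linkGraph G S).Adj v b) →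
      (∀ b, (linkGraph G S).Adj v b → b ∈ B) → ∃ B S₀, IsEndBlock G S B S₀ := by
    intro B hvB hB hB'
    have hc : IsCliqueBlock G B := by
      refine ⟨⟨v, hvB⟩, fun x hx y hy hxy => ?_⟩
      rcases hB x hx with rfl | h1 <;> rcases hB y hy with rfl | h2
      · exact absurd rfl hxy
      · exact h2.1
      · exact h1.1.symm
      · exact absurd ((h x h1).trans (h y h2).symm) hxy
    refine ⟨B, {v}, .inl hc, ⟨v, hvB⟩, ?_, by simpa using hvB, by simp [blockWeight, hc], ?_, ?_, ?_⟩
    · simp [indepCpx]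
    · intro b hb
      rcases hB b hb with rfl | h1
      exacts [hv, h1.2.2]
    · intro b hb
      rcases hB b hb with rfl | h1
      · simp
      · exact .inr ⟨v, by simp, h1.1⟩
    · intro s hs b hb
      rw [Finset.mem_singleton] at hs
      exact hB' b (hs ▸ hb)
  by_cases hva : (linkGraph G S).Adj v a
  · refine mk {v, a} (by simp) (fun b hb => ?_) fun b hb => by simp [h b hb]
    rcases Finset.mem_insert.mp hb with rfl | hb
    · simp
    · rw [Finset.mem_singleton] at hb
      exact .inr (hb ▸ hva)
  · exact mk {v} (by simp) (by simp) fun b hb => absurd (h b hb ▸ hb) hva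

end Blocks

section EndBlock
variable {V : Type}

lemma injective_vec_seven {α : Type*} {a b c d e f g : α} (h : [a, b, c, d, e, f, g].Nodup) :
    Function.Injective ![a, b, c, d, e, f, g] := by
  rw [← List.nodup_ofFn]
  simpa [List.ofFn_succ] using h

lemma not_adj_of_linkGraph {G : SimpleGraph V} {S : Finset V} {a b : V} (ha : InLink G S a)
    (hb : InLink G S b) (h : ¬ (linkGraph G S).Adj a b) : ¬ G.Adj a b := fun h' => h ⟨h', ha, hb⟩

lemma Tame.exists_isEndBlock [Fintype V] {G : SimpleGraph V} {α : ℕ} (hG : Tame G α)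
    {S : Finset V} (hS : indepCpx G S) (hne : ∃ v, InLink G S v) :
    ∃ B S₀, IsEndBlock G S B S₀ := by
  classical
  by_cases hdeg : ∀ v, InLink G S v → ∀ a, ∃ b, b ≠ a ∧ (linkGraph G S).Adj v b
  swap
  · push Not at hdeg
    obtain ⟨v, hv, a, ha⟩ := hdeg
    exact exists_isEndBlock_of_leaf hv fun b hb => by
      by_contra h
      exact ha b h hb
  obtain ⟨D, x, y₀, z, hy₀, hz, hyz, hxD, hx, hD, htwo⟩ := hG.exists_end_cycle hne hdeg
  set H := linkGraph G S with hH
  have hxy₀ : H.Adj x y₀ := (hx _ hy₀).2 (.inl rfl)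
  have hxz : H.Adj x z := (hx _ hz).2 (.inr rfl)
  have hnadj : ∀ {a b : V}, InLink G S a → InLink G S b → ¬ H.Adj a b → ¬ G.Adj a b :=
    fun ha hb h => not_adj_of_linkGraph ha hb h
  have hpair : ∀ e ∈ D, ∀ {a b}, a ≠ b → H.Adj e a → H.Adj e b →
      ∀ v, H.Adj e v ↔ v = a ∨ v = b := by
    intro e he a b hab ha hb
    obtain ⟨c, -, hc⟩ := htwo e he a ha
    have := (hc b).1 hb
    rwa [← this.resolve_left hab.symm] at hc
  obtain ⟨y₁, hy₁x, n₀⟩ := htwo y₀ hy₀ x hxy₀.symm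
  have h01 : H.Adj y₀ y₁ := (n₀ _).2 (.inr rfl)
  have hy₁ : y₁ ∈ D := (hD _ hy₀ _ h01).resolve_right hy₁x
  have lx := hxy₀.2.1
  have l0 := hxy₀.2.2
  have l1 := h01.2.2
  have lz := hxz.2.2
  by_cases e1 : y₁ = z
  · -- a triangle
    subst e1
    have hc : IsCliqueBlock G {x, y₀, y₁} := by
      refine ⟨⟨x, by simp⟩, fun a ha b hb hab => ?_⟩
      simp only [Finset.mem_insert, Finset.mem_singleton] at ha hb
      have := hxy₀.1
      have := hxz.1
      have := h01.1
      rcases ha with rfl | rfl | rfl <;> rcases hb with rfl | rfl | rfl <;>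
        first | exact absurd rfl hab | assumption | (apply SimpleGraph.Adj.symm; assumption)
    refine ⟨{x, y₀, y₁}, {y₀}, .inl hc, ⟨x, by simp⟩, by simp [indepCpx], by simp,
      by simp [blockWeight, hc], by simp [lx, l0, l1], ?_, ?_⟩
    · intro b hb
      simp only [Finset.mem_insert, Finset.mem_singleton] at hb
      rcases hb with rfl | rfl | rfl
      · exact .inr ⟨y₀, by simp, hxy₀.1.symm⟩
      · simp
      · exact .inr ⟨y₀, by simp, h01.1⟩
    · intro s hs v hv
      rw [Finset.mem_singleton] at hs
      subst hs
      rcases (n₀ v).1 hv with rfl | rfl <;> simp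
  have hxy₁ : ¬ H.Adj x y₁ := fun h => ((hx _ hy₁).1 h).elim h01.ne' e1
  obtain ⟨y₂, hy₂0, n₁⟩ := htwo y₁ hy₁ y₀ h01.symm
  have h12 : H.Adj y₁ y₂ := (n₁ _).2 (.inr rfl)
  have hy₂x : y₂ ≠ x := fun h => hxy₁ (h ▸ h12.symm)
  have hy₂ : y₂ ∈ D := (hD _ hy₁ _ h12).resolve_right hy₂x
  have l2 := h12.2.2
  have h02 : ¬ H.Adj y₀ y₂ := fun h => ((n₀ _).1 h).elim hy₂x h12.ne'
  by_cases e2 : y₂ = z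
  · -- a square
    subst e2
    have n₂ : ∀ v, H.Adj y₂ v ↔ v = x ∨ v = y₁ := hpair _ hy₂ (Ne.symm hy₁x) hxz.symm h12.symm
    by_cases hu : ∃ u, H.Adj x u ∧ u ∉ D
    · obtain ⟨u, hxu, huD⟩ := hu
      have hu1 : ¬ H.Adj y₁ u := fun h => (hD _ hy₁ _ h).elim huD hxu.ne'
      have hT : indepCpx G (insert y₁ (insert u S)) := by
        refine indepCpx_insert (indepCpx_insert hS hxu.2.2.2) ?_
        have := l1.2
        have h := hnadj hxu.2.2 l1 (fun h => hu1 h.symm)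
        simpa [h] using this
      refine (hG.not_swap (S := S) (a := y₀) (b := y₁) (c := y₂) ?_ hT (by simp) h01.symm h12
        (hnadj l0 l2 h02) hy₂0.symm ?_ ?_).elim
      · exact (Finset.subset_insert _ _).trans (Finset.subset_insert _ _)
      · intro v hv
        rcases (n₀ v).1 hv with rfl | rfl
        · exact .inr ⟨u, by simp, hxu.1.symm⟩
        · exact .inl rfl
      · intro v hv
        rcases (n₂ v).1 hv with rfl | rfl
        · exact .inr ⟨u, by simp, hxu.1.symm⟩
        · exact .inl rfl
    · push Not at hu
      have nx : ∀ v, H.Adj x v ↔ v = y₀ ∨ v = y₂ :=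
        fun v => ⟨fun h => (hx v (hu v h)).1 h, by rintro (rfl | rfl) <;> assumption⟩
      obtain ⟨S', hS', hL⟩ := hG.exists_link_eq hS
        (fun v => v = x ∨ v = y₀ ∨ v = y₁ ∨ v = y₂) (by rintro v (rfl | rfl | rfl | rfl) <;> assumption)
        (by
          rintro v w (rfl | rfl | rfl | rfl) hvw
          · have := (nx w).1 hvw; tauto
          · have := (n₀ w).1 hvw; tauto
          · have := (n₁ w).1 hvw; tauto
          · have := (n₂ w).1 hvw; tauto)
      exact (hG.not_four S' hS' x y₀ y₁ y₂ (hnadj lx l1 hxy₁) hy₁x.symm hxy₀.1 h01.1 h12.1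
        hxz.1.symm hL).elim
  have hxy₂ : ¬ H.Adj x y₂ := fun h => ((hx _ hy₂).1 h).elim hy₂0 e2
  obtain ⟨y₃, hy₃1, n₂⟩ := htwo y₂ hy₂ y₁ h12.symm
  have h23 : H.Adj y₂ y₃ := (n₂ _).2 (.inr rfl)
  have hy₃x : y₃ ≠ x := fun h => hxy₂ (h ▸ h23.symm)
  have hy₃ : y₃ ∈ D := (hD _ hy₂ _ h23).resolve_right hy₃x
  have l3 := h23.2.2
  have hy₃0 : y₃ ≠ y₀ := fun h => h02 (h ▸ h23.symm)
  have h13 : ¬ H.Adj y₁ y₃ := fun h => ((n₁ _).1 h).elim hy₃0 h23.ne'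
  have h03 : ¬ H.Adj y₀ y₃ := fun h => ((n₀ _).1 h).elim hy₃x hy₃1
  by_cases e3 : y₃ = z
  · -- a pentagon
    subst e3
    have n₃ : ∀ v, H.Adj y₃ v ↔ v = x ∨ v = y₂ := hpair _ hy₃ (Ne.symm hy₂x) hxz.symm h23.symm
    have hp : IsPentagonBlock G {x, y₀, y₁, y₂, y₃} :=
      ⟨x, y₀, y₁, y₂, y₃, by simp, hxy₀.1, h01.1, h12.1, h23.1, hxz.1.symm, hnadj lx l1 hxy₁,
        hnadj l0 l2 h02, hnadj l1 l3 h13, hnadj l2 lx fun h => hxy₂ h.symm,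
        hnadj l3 l0 fun h => h03 h.symm⟩
    refine ⟨{x, y₀, y₁, y₂, y₃}, {y₁, y₃}, .inr hp, ⟨x, by simp⟩, ?_, ?_, ?_, ?_, ?_, ?_⟩
    · have := hnadj l1 l3 h13
      intro a ha b hb
      simp only [Finset.mem_insert, Finset.mem_singleton] at ha hb
      rcases ha with rfl | rfl <;> rcases hb with rfl | rfl
      · exact G.loopless.irrefl _
      · exact this
      · exact fun h => this h.symm
      · exact G.loopless.irrefl _
    · simp [Finset.insert_subset_iff]
    · rw [blockWeight, if_neg hp.not_isCliqueBlock, Finset.card_pair hy₃1.symm]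
    · simp [lx, l0, l1, l2, l3]
    · intro b hb
      simp only [Finset.mem_insert, Finset.mem_singleton] at hb
      rcases hb with rfl | rfl | rfl | rfl | rfl
      · exact .inr ⟨y₃, by simp, hxz.1.symm⟩
      · exact .inr ⟨y₁, by simp, h01.1.symm⟩
      · simp
      · exact .inr ⟨y₁, by simp, h12.1⟩
      · simp
    · intro s hs v hv
      simp only [Finset.mem_insert, Finset.mem_singleton] at hs
      rcases hs with rfl | rfl
      · rcases (n₁ v).1 hv with rfl | rfl <;> simp
      · rcases (n₃ v).1 hv with rfl | rfl <;> simp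
  have hxy₃ : ¬ H.Adj x y₃ := fun h => ((hx _ hy₃).1 h).elim hy₃0 e3
  obtain ⟨y₄, hy₄2, n₃⟩ := htwo y₃ hy₃ y₂ h23.symm
  have h34 : H.Adj y₃ y₄ := (n₃ _).2 (.inr rfl)
  have hy₄x : y₄ ≠ x := fun h => hxy₃ (h ▸ h34.symm)
  have hy₄ : y₄ ∈ D := (hD _ hy₃ _ h34).resolve_right hy₄x
  have l4 := h34.2.2
  have hy₄0 : y₄ ≠ y₀ := fun h => h03 (h ▸ h34.symm)
  have hy₄1 : y₄ ≠ y₁ := fun h => h13 (h ▸ h34.symm)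
  have h14 : ¬ H.Adj y₁ y₄ := fun h => ((n₁ _).1 h).elim hy₄0 hy₄2
  have swap : ∀ u, H.Adj x u → ¬ H.Adj y₁ u → ¬ H.Adj y₄ u → False := by
    intro u hxu hu1 hu4
    have hT : indepCpx G (insert y₁ (insert y₄ (insert u S))) := by
      refine indepCpx_insert (indepCpx_insert (indepCpx_insert hS hxu.2.2.2) ?_) ?_
      · have h := hnadj hxu.2.2 l4 (fun h => hu4 h.symm)
        simpa [h] using l4.2
      · have h := hnadj hxu.2.2 l1 (fun h => hu1 h.symm)
        have h' := hnadj l4 l1 (fun h => h14 h.symm)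
        simpa [h, h'] using l1.2
    refine hG.not_swap (S := S) (a := y₀) (b := y₁) (c := y₂) ?_ hT (by simp) h01.symm h12
      (hnadj l0 l2 h02) hy₂0.symm ?_ ?_
    · exact (Finset.subset_insert _ _).trans
        ((Finset.subset_insert _ _).trans (Finset.subset_insert _ _))
    · intro v hv
      rcases (n₀ v).1 hv with rfl | rfl
      · exact .inr ⟨u, by simp, hxu.1.symm⟩
      · exact .inl rfl
    · intro v hv
      rcases (n₂ v).1 hv with rfl | rfl
      · exact .inl rfl
      · exact .inr ⟨y₄, by simp, h34.1.symm⟩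
  have hnx : ∀ u, H.Adj x u → u ∈ D := by
    intro u hxu
    by_contra huD
    exact swap u hxu (fun h => (hD _ hy₁ _ h).elim huD hxu.ne')
      (fun h => (hD _ hy₄ _ h).elim huD hxu.ne')
  have hz1 : ¬ H.Adj y₁ z := fun h => ((n₁ _).1 h).elim hyz.symm (Ne.symm e2)
  have h4z : H.Adj y₄ z := by
    by_contra h
    exact swap z hxz hz1 h
  have nx : ∀ v, H.Adj x v ↔ v = y₀ ∨ v = z :=
    fun v => ⟨fun h => (hx v (hnx v h)).1 h, by rintro (rfl | rfl) <;> assumption⟩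
  have n₄ : ∀ v, H.Adj y₄ v ↔ v = y₃ ∨ v = z := hpair _ hy₄ e3 h34.symm h4z
  have nz : ∀ v, H.Adj z v ↔ v = x ∨ v = y₄ := hpair _ hz (Ne.symm hy₄x) hxz.symm h4z.symm
  let p : Fin 7 → V := ![x, y₄, y₂, y₀, z, y₃, y₁]
  have hlp : ∀ i, InLink G S (p i) := by
    intro i
    fin_cases i <;> assumption
  have hnp : ∀ i v, H.Adj (p i) v ↔ v = p (i + 3) ∨ v = p (i - 3) := by
    intro i v
    fin_cases i
    · exact nx v
    · exact (n₄ v).trans or_comm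
    · exact (n₂ v).trans or_comm
    · exact (n₀ v).trans or_comm
    · exact nz v
    · exact (n₃ v).trans or_comm
    · exact (n₁ v).trans or_comm
  have hinj : Function.Injective p := by
    refine injective_vec_seven ?_
    simp only [List.nodup_cons, List.mem_cons, List.not_mem_nil, or_false, not_or,
      List.nodup_nil, and_true, not_false_eq_true]
    exact ⟨⟨Ne.symm hy₄x, Ne.symm hy₂x, hxy₀.ne, hxz.ne, Ne.symm hy₃x, Ne.symm hy₁x⟩,
      ⟨hy₄2, hy₄0, h4z.ne, h34.ne', hy₄1⟩, ⟨hy₂0, e2, h23.ne, h12.ne'⟩,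
      ⟨hyz, Ne.symm hy₃0, h01.ne⟩, ⟨Ne.symm e3, Ne.symm e1⟩, hy₃1⟩
  obtain ⟨S', hS', hL⟩ := hG.exists_link_eq hS (fun v => ∃ i, v = p i)
    (by rintro v ⟨i, rfl⟩; exact hlp i)
    (by
      rintro v w ⟨i, rfl⟩ hvw
      rcases (hnp i w).1 hvw with h | h
      exacts [⟨_, h⟩, ⟨_, h⟩])
  refine (hG.not_seven S' hS' p hinj ?_ hL).elim
  intro i j
  have : G.Adj (p i) (p j) ↔ H.Adj (p i) (p j) := ⟨fun h => ⟨h, hlp i, hlp j⟩, fun h => h.1⟩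
  rw [this, hnp, hinj.eq_iff, hinj.eq_iff]
  clear this
  revert i j
  decide

end EndBlock

section BlockDecomposition
variable {V : Type} [DecidableEq V]

lemma card_inter_le_blockWeight {G : SimpleGraph V} {B M : Finset V}
    (hB : IsCliqueBlock G B ∨ IsPentagonBlock G B) (hM : indepCpx G M) :
    (M ∩ B).card ≤ blockWeight G B := by
  by_cases hc : IsCliqueBlock G B
  · rw [blockWeight, if_pos hc, Finset.card_le_one]
    intro a ha b hb
    rw [Finset.mem_inter] at ha hb
    by_contra hab
    exact hM a ha.1 b hb.1 (hc.2 a ha.2 b hb.2 hab)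
  · rw [blockWeight, if_neg hc]
    obtain ⟨a, b, c, d, e, hB, hp⟩ := hB.resolve_left hc
    by_contra! h
    obtain ⟨u, hu, v, hv, w, hw, huv, huw, hvw⟩ := Finset.two_lt_card.mp h
    simp only [Finset.mem_inter, hB] at hu hv hw
    have h1 := hM u hu.1 v hv.1
    have h2 := hM u hu.1 w hw.1
    have h3 := hM v hv.1 w hw.1
    have := hp.ab
    have := hp.bc
    have := hp.cd
    have := hp.de
    have := hp.ea
    have h1' := fun h => h1 (G.adj_symm h)
    have h2' := fun h => h2 (G.adj_symm h)
    have h3' := fun h => h3 (G.adj_symm h)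
    rcases hu.2 with rfl | rfl | rfl | rfl | rfl <;> rcases hv.2 with rfl | rfl | rfl | rfl | rfl <;>
      rcases hw.2 with rfl | rfl | rfl | rfl | rfl <;> contradiction

lemma Tame.exists_blocks_link [Fintype V] {G : SimpleGraph V} {α : ℕ} (hG : Tame G α)
    (S : Finset V) (hS : indepCpx G S) :
    ∃ 𝓑 : Finset (Finset V), (∀ B ∈ 𝓑, B.Nonempty ∧ (IsCliqueBlock G B ∨ IsPentagonBlock G B)) ∧
      (∀ v, InLink G S v ↔ ∃ B ∈ 𝓑, v ∈ B) ∧ (∀ B ∈ 𝓑, ∀ B' ∈ 𝓑, ∀ v ∈ B, v ∈ B' → B = B') ∧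
      S.card + ∑ B ∈ 𝓑, blockWeight G B = α := by
  classical
  induction hn : (Finset.univ.filter fun v => InLink G S v).card using Nat.strong_induction_on
    generalizing S with
  | _ n ih =>
    by_cases hne : ∃ v, InLink G S v
    swap
    · push Not at hne
      refine ⟨∅, by simp, by simpa using hne, by simp, ?_⟩
      simpa using hG.card_eq_of_maximal hS hne
    obtain ⟨B, S₀, hB⟩ := hG.exists_isEndBlock hS hne
    have hlink : ∀ v, InLink G (S ∪ S₀) v ↔ InLink G S v ∧ v ∉ B := by
      intro v
      constructor
      · rintro ⟨h1, h2⟩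
        rw [Finset.notMem_union] at h1
        refine ⟨⟨h1.1, fun s hs => h2 s (Finset.mem_union_left _ hs)⟩, fun hv => ?_⟩
        rcases hB.cover v hv with h | ⟨s, hs, h⟩
        · exact h1.2 h
        · exact h2 s (Finset.mem_union_right _ hs) h
      · rintro ⟨h1, h2⟩
        refine ⟨?_, fun s hs hsv => ?_⟩
        · rw [Finset.notMem_union]
          exact ⟨h1.1, fun h => h2 (hB.subset h)⟩
        · rcases Finset.mem_union.mp hs with hs | hs
          · exact h1.2 s hs hsv
          · exact h2 (hB.nbr s hs v ⟨hsv, hB.inLink s (hB.subset hs), h1⟩)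
    have hind : indepCpx G (S ∪ S₀) := by
      intro a ha b hb
      rcases Finset.mem_union.mp ha with ha | ha <;> rcases Finset.mem_union.mp hb with hb | hb
      · exact hS a ha b hb
      · exact (hB.inLink b (hB.subset hb)).2 a ha
      · exact fun h => (hB.inLink a (hB.subset ha)).2 b hb h.symm
      · exact hB.indep a ha b hb
    have hcard : (S ∪ S₀).card = S.card + blockWeight G B := by
      rw [Finset.card_union_of_disjoint, hB.card]
      rw [Finset.disjoint_right]
      exact fun s hs => (hB.inLink s (hB.subset hs)).1
    obtain ⟨b, hb⟩ := hB.nonempty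
    obtain ⟨𝓑, h1, h2, h3, h4⟩ := ih _ (by
      rw [← hn]
      refine Finset.card_lt_card (Finset.ssubset_iff_of_subset ?_ |>.mpr ⟨b, ?_, ?_⟩)
      · intro v hv
        simp only [Finset.mem_filter, Finset.mem_univ, true_and, hlink] at hv ⊢
        exact hv.1
      · simpa using hB.inLink b hb
      · simp [hlink, hb]) (S ∪ S₀) hind rfl
    have hdisj : ∀ B' ∈ 𝓑, ∀ v ∈ B', v ∉ B := fun B' hB' v hv =>
      ((hlink v).1 ((h2 v).2 ⟨B', hB', hv⟩)).2
    have hnotMem : B ∉ 𝓑 := fun h => hdisj B h b hb hb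
    refine ⟨insert B 𝓑, ?_, ?_, ?_, ?_⟩
    · simpa using ⟨⟨hB.nonempty, hB.block⟩, h1⟩
    · intro v
      simp only [Finset.exists_mem_insert]
      rw [← h2, hlink]
      have := hB.inLink v
      tauto
    · intro B₁ hB₁ B₂ hB₂ v hv₁ hv₂
      rcases Finset.mem_insert.mp hB₁ with h₁ | h₁ <;>
        rcases Finset.mem_insert.mp hB₂ with h₂ | h₂
      · rw [h₁, h₂]
      · exact absurd (h₁ ▸ hv₁) (hdisj _ h₂ _ hv₂)
      · exact absurd (h₂ ▸ hv₂) (hdisj _ h₁ _ hv₁)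
      · exact h3 _ h₁ _ h₂ v hv₁ hv₂
    · rw [Finset.sum_insert hnotMem, ← add_assoc, ← hcard, h4]

/-- A partition of the vertices of `G` into cliques and pentagons each of which meets every
maximal independent set in as many vertices as possible. -/
structure IsBlockDecomposition (G : SimpleGraph V) (α : ℕ) (𝓑 : Finset (Finset V)) : Prop where
  block : ∀ B ∈ 𝓑, IsCliqueBlock G B ∨ IsPentagonBlock G B
  exists_mem : ∀ v, ∃ B ∈ 𝓑, v ∈ B
  eq_of_mem : ∀ B ∈ 𝓑, ∀ B' ∈ 𝓑, ∀ v ∈ B, v ∈ B' → B = B'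
  card_inter : ∀ B ∈ 𝓑, ∀ M, indepCpx G M → M.card = α → (M ∩ B).card = blockWeight G B

lemma Tame.exists_isBlockDecomposition [Fintype V] {G : SimpleGraph V} {α : ℕ} (hG : Tame G α) :
    ∃ 𝓑, IsBlockDecomposition G α 𝓑 := by
  obtain ⟨𝓑, h1, h2, h3, h4⟩ := hG.exists_blocks_link ∅ (by simp [indepCpx])
  have hex : ∀ v, ∃ B ∈ 𝓑, v ∈ B := fun v => (h2 v).1 (by simp [InLink])
  refine ⟨𝓑, fun B hB => (h1 B hB).2, hex, h3, ?_⟩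
  intro B hB M hM hcard
  have hU : M = 𝓑.biUnion fun B => M ∩ B := by
    ext v
    obtain ⟨B, hB⟩ := hex v
    simp only [Finset.mem_biUnion, Finset.mem_inter]
    exact ⟨fun h => ⟨B, hB.1, h, hB.2⟩, fun ⟨_, _, h, _⟩ => h⟩
  have hsum : ∑ B ∈ 𝓑, (M ∩ B).card = ∑ B ∈ 𝓑, blockWeight G B := by
    rw [← Finset.card_biUnion, ← hU, hcard, ← h4, Finset.card_empty, zero_add]
    intro B hB B' hB' hne
    rw [Function.onFun, Finset.disjoint_left]
    intro v hv hv'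
    exact hne (h3 B hB B' hB' v (Finset.mem_inter.mp hv).2 (Finset.mem_inter.mp hv').2)
  exact (Finset.sum_eq_sum_iff_of_le fun B hB =>
    card_inter_le_blockWeight (h1 B hB).2 hM).1 hsum B hB

end BlockDecomposition

section BlockShapes
variable {V : Type}

/-- `B` is a clique containing the closed neighbourhood of `z`. -/
structure IsSimplexAt (G : SimpleGraph V) (B : Finset V) (z : V) : Prop where
  mem : z ∈ B
  clique : ∀ a ∈ B, ∀ b ∈ B, a ≠ b → G.Adj a b
  nbr : ∀ v, G.Adj z v → v ∈ B

/-- `B = {z, w}` is an edge whose endpoints have degree two, lying on the four-cycle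
`z, w, w', z'`. -/
structure IsSquareEdge (G : SimpleGraph V) (B : Finset V) (z w z' w' : V) : Prop where
  mem_iff : ∀ v, v ∈ B ↔ v = z ∨ v = w
  adj : G.Adj z w
  adj_left : G.Adj z z'
  adj_right : G.Adj w w'
  adj_top : G.Adj z' w'
  left_notMem : z' ∉ B
  right_notMem : w' ∉ B
  nbr_left : ∀ v, G.Adj z v → v = w ∨ v = z'
  nbr_right : ∀ v, G.Adj w v → v = z ∨ v = w'

/-- `B` is an induced pentagon in which only `a` and `c` can have neighbours outside `B`. -/
structure IsPentagonAt (G : SimpleGraph V) (B : Finset V) (a b c d e : V) : Prop where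
  mem_iff : ∀ v, v ∈ B ↔ v = a ∨ v = b ∨ v = c ∨ v = d ∨ v = e
  pentagon : IsPentagon G a b c d e
  nbr_b : ∀ v, G.Adj b v → v = a ∨ v = c
  nbr_d : ∀ v, G.Adj d v → v = c ∨ v = e
  nbr_e : ∀ v, G.Adj e v → v = d ∨ v = a

lemma IsPentagon.rotate {G : SimpleGraph V} {a b c d e : V} (h : IsPentagon G a b c d e) :
    IsPentagon G b c d e a :=
  ⟨h.bc, h.cd, h.de, h.ea, h.ab, h.bd, h.ce, h.da, h.eb, h.ac⟩

lemma pentagon_cases {A B C D E P : Prop} (hab : A ∨ B) (hbc : B ∨ C) (hcd : C ∨ D) (hde : D ∨ E)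
    (hea : E ∨ A) (h₀ : B → D → E → P) (h₁ : C → E → A → P) (h₂ : D → A → B → P)
    (h₃ : E → B → C → P) (h₄ : A → C → D → P) : P := by
  grind

variable [DecidableEq V] {G : SimpleGraph V} {α : ℕ} {𝓑 : Finset (Finset V)}

lemma indepCpx_pair {a b : V} (h : ¬ G.Adj a b) : indepCpx G {a, b} := by
  intro u hu v hv
  simp only [Finset.mem_insert, Finset.mem_singleton] at hu hv
  rcases hu with rfl | rfl <;> rcases hv with rfl | rfl
  · exact G.loopless.irrefl _
  · exact h
  · exact fun h' => h h'.symm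
  · exact G.loopless.irrefl _

lemma IsBlockDecomposition.shape_of_isCliqueBlock (h𝓑 : IsBlockDecomposition G α 𝓑)
    (hG : Tame G α) {B : Finset V} (hB : B ∈ 𝓑) (hc : IsCliqueBlock G B) :
    (∃ z, IsSimplexAt G B z) ∨ ∃ z w z' w', IsSquareEdge G B z w z' w' := by
  by_cases hs : ∃ z ∈ B, ∀ v, G.Adj z v → v ∈ B
  · obtain ⟨z, hz, hz'⟩ := hs
    exact .inl ⟨z, hz, hc.2, hz'⟩
  right
  push Not at hs
  have hne : ∀ {b v : V}, b ∈ B → v ∉ B → v ≠ b := fun hb hv h => hv (h ▸ hb)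
  have key : ∀ T, indepCpx G T → (∀ b ∈ B, ∃ t ∈ T, G.Adj b t) → False := by
    intro T hT hTB
    obtain ⟨M, hTM, hM, hcard⟩ := hG.exists_extend T hT
    have h1 := h𝓑.card_inter B hB M hM hcard
    rw [blockWeight, if_pos hc] at h1
    obtain ⟨b, hb⟩ := Finset.card_pos.mp (by omega : 0 < (M ∩ B).card)
    rw [Finset.mem_inter] at hb
    obtain ⟨t, ht, hbt⟩ := hTB b hb.2
    exact hM b hb.1 t (hTM ht) hbt
  choose! f hf hfB using hs
  have hex : ∃ b ∈ B, ∃ c ∈ B, G.Adj (f b) (f c) := by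
    by_contra! h
    refine key (B.image f) ?_ fun b hb => ⟨f b, Finset.mem_image_of_mem f hb, hf b hb⟩
    intro u hu v hv
    obtain ⟨b, hb, rfl⟩ := Finset.mem_image.mp hu
    obtain ⟨c, hc, rfl⟩ := Finset.mem_image.mp hv
    exact h b hb c hc
  obtain ⟨b, hb, c, hcB, hbc⟩ := hex
  have hbcne : b ≠ c := by
    rintro rfl
    exact G.loopless.irrefl _ hbc
  have hmem : ∀ v, v ∈ B ↔ v = b ∨ v = c := by
    refine fun d => ⟨fun hd => ?_, by rintro (rfl | rfl) <;> assumption⟩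
    by_contra! hdne
    refine hG.not_conn b c d (f b) (hc.2 _ hb _ hcB hbcne) (hc.2 _ hb _ hd hdne.1.symm) (hf b hb)
      hdne.2 (hne hcB (hfB b hb)) (hne hd (hfB b hb)).symm
      (.of_adj (hc.2 _ hd _ hcB hdne.2) hdne.1.symm hbcne)
      ((ConnAvoiding.of_adj hbc (hf b hb).ne (hne hb (hfB c hcB)).symm).trans
        (.of_adj (hf c hcB).symm (hne hb (hfB c hcB)).symm hbcne))
  have hcross : ∀ u v, u ∉ B → v ∉ B → G.Adj b u → G.Adj c v → G.Adj u v := by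
    intro u v hu hv hbu hcv
    by_contra h
    refine key {u, v} (indepCpx_pair h) fun d hd => ?_
    rcases (hmem d).1 hd with rfl | rfl
    · exact ⟨u, by simp, hbu⟩
    · exact ⟨v, by simp, hcv⟩
  have hadj := hc.2 _ hb _ hcB hbcne
  have hfc := hf c hcB
  have hfb := hf b hb
  have hfb' := hfB b hb
  have hfc' := hfB c hcB
  refine ⟨b, c, f b, f c, hmem, hadj, hfb, hfc, hbc, hfb', hfc', fun u hu => ?_, fun u hu => ?_⟩
  · by_contra! h
    have huB : u ∉ B := fun h' => ((hmem u).1 h').elim hu.ne' h.1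
    exact hG.not_conn b c u (f b) hadj hu hfb h.1 (hne hcB hfb') h.2
      ((ConnAvoiding.of_adj (hcross u _ huB hfc' hu hfc) hu.ne (hne hb hfc').symm).trans
        (.of_adj hfc.symm (hne hb hfc').symm hbcne))
      ((ConnAvoiding.of_adj hbc hfb.ne (hne hb hfc').symm).trans
        (.of_adj hfc.symm (hne hb hfc').symm hbcne))
  · by_contra! h
    have huB : u ∉ B := fun h' => ((hmem u).1 h').elim h.1 hu.ne'
    exact hG.not_conn c b u (f c) hadj.symm hu hfc h.1 (hne hb hfc') h.2
      ((ConnAvoiding.of_adj (hcross _ u hfb' huB hfb hu).symm hu.ne (hne hcB hfb').symm).trans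
        (.of_adj hfb.symm (hne hcB hfb').symm hbcne.symm))
      ((ConnAvoiding.of_adj hbc.symm hfc.ne (hne hcB hfb').symm).trans
        (.of_adj hfb.symm (hne hcB hfb').symm hbcne.symm))

lemma IsBlockDecomposition.not_adj_outer (h𝓑 : IsBlockDecomposition G α 𝓑)
    (hG : Tame G α) {B : Finset V} (hB : B ∈ 𝓑) {a b c d e a' b' : V}
    (hmem : ∀ v, v ∈ B ↔ v = a ∨ v = b ∨ v = c ∨ v = d ∨ v = e) (hp : IsPentagon G a b c d e)
    (haa : G.Adj a a') (ha' : a' ∉ B) (hbb : G.Adj b b') (hb' : b' ∉ B) : False := by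
  have hne : ∀ {x v : V}, x ∈ B → v ∉ B → v ≠ x := fun hb hv h => hv (h ▸ hb)
  have ma : a ∈ B := by simp [hmem]
  have mb : b ∈ B := by simp [hmem]
  have mc : c ∈ B := by simp [hmem]
  have md : d ∈ B := by simp [hmem]
  have me : e ∈ B := by simp [hmem]
  have had : a ≠ d := fun h => hp.ac (h ▸ hp.cd.symm)
  have hac : a ≠ c := fun h => hp.da (h ▸ hp.cd.symm)
  have hbd : b ≠ d := fun h => hp.eb (h ▸ hp.de.symm)
  have hbe : b ≠ e := fun h => hp.bd (h ▸ hp.de.symm)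
  have hda : ConnAvoiding G a d b :=
    (ConnAvoiding.of_adj hp.cd.symm had hac).trans (.of_adj hp.bc.symm hac hp.ab.ne)
  have hea : ConnAvoiding G a e b := (ConnAvoiding.of_adj hp.de.symm hp.ea.ne' had).trans hda
  have hdb : ConnAvoiding G b d a :=
    (ConnAvoiding.of_adj hp.de hbd hbe).trans (.of_adj hp.ea hbe hp.ab.ne')
  have hcb : ConnAvoiding G b c a := (ConnAvoiding.of_adj hp.cd hp.bc.ne hbd).trans hdb
  have hA : ¬ ConnAvoiding G a a' b := hG.not_conn a b e a' hp.ab hp.ea.symm haa hbe.symm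
    (hne mb ha') (hne me ha').symm hea
  have hB' : ¬ ConnAvoiding G b b' a := hG.not_conn b a c b' hp.ab.symm hp.bc hbb hac.symm
    (hne ma hb') (hne mc hb').symm hcb
  have h1 : a' ≠ b' := by
    rintro rfl
    exact hA (.of_adj hbb.symm haa.ne hp.ab.ne)
  have h2 : ¬ G.Adj a' b' := fun h =>
    hA ((ConnAvoiding.of_adj h haa.ne (hne ma hb').symm).trans
      (.of_adj hbb.symm (hne ma hb').symm hp.ab.ne))
  have h3 : ¬ G.Adj d a' := fun h => hA ((ConnAvoiding.of_adj h.symm haa.ne had).trans hda)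
  have h4 : ¬ G.Adj d b' := fun h => hB' ((ConnAvoiding.of_adj h.symm hbb.ne hbd).trans hdb)
  obtain ⟨M, hTM, hM, hcard⟩ := hG.exists_extend (insert d {a', b'})
    (indepCpx_insert (indepCpx_pair h2) (by simp [G.adj_comm _ d, h3, h4]))
  have h5 := h𝓑.card_inter B hB M hM hcard
  rw [blockWeight, if_neg (IsPentagonBlock.not_isCliqueBlock ⟨a, b, c, d, e, hmem, hp⟩)] at h5
  have : M ∩ B ⊆ {d} := by
    intro v hv
    rw [Finset.mem_inter, hmem] at hv
    have m1 := hTM (show a' ∈ _ by simp)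
    have m2 := hTM (show b' ∈ _ by simp)
    have m3 := hTM (show d ∈ _ by simp)
    rcases hv.2 with rfl | rfl | rfl | rfl | rfl
    · exact absurd haa (hM _ hv.1 _ m1)
    · exact absurd hbb (hM _ hv.1 _ m2)
    · exact absurd hp.cd (hM _ hv.1 _ m3)
    · simp
    · exact absurd hp.de (hM _ m3 _ hv.1)
  have := Finset.card_le_card this
  rw [Finset.card_singleton] at this
  omega

lemma IsBlockDecomposition.shape_of_isPentagonBlock (h𝓑 : IsBlockDecomposition G α 𝓑)
    (hG : Tame G α) {B : Finset V} (hB : B ∈ 𝓑) (hc : IsPentagonBlock G B) :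
    ∃ a b c d e, IsPentagonAt G B a b c d e := by
  obtain ⟨a, b, c, d, e, hmem, hp⟩ := hc
  have main : ∀ a b c d e, (∀ v, v ∈ B ↔ v = a ∨ v = b ∨ v = c ∨ v = d ∨ v = e) →
      IsPentagon G a b c d e → (∀ v, G.Adj b v → v ∈ B) → (∀ v, G.Adj d v → v ∈ B) →
      (∀ v, G.Adj e v → v ∈ B) → ∃ a b c d e, IsPentagonAt G B a b c d e := by
    intro a b c d e hmem hp hb hd he
    refine ⟨a, b, c, d, e, hmem, hp, fun v hv => ?_, fun v hv => ?_, fun v hv => ?_⟩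
    · rcases (hmem v).1 (hb v hv) with rfl | rfl | rfl | rfl | rfl
      · simp
      · exact absurd hv (G.loopless.irrefl _)
      · simp
      · exact absurd hv hp.bd
      · exact absurd hv.symm hp.eb
    · rcases (hmem v).1 (hd v hv) with rfl | rfl | rfl | rfl | rfl
      · exact absurd hv hp.da
      · exact absurd hv.symm hp.bd
      · simp
      · exact absurd hv (G.loopless.irrefl _)
      · simp
    · rcases (hmem v).1 (he v hv) with rfl | rfl | rfl | rfl | rfl
      · simp
      · exact absurd hv hp.eb
      · exact absurd hv.symm hp.ce
      · simp
      · exact absurd hv (G.loopless.irrefl _)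
  have hno : ∀ a b c d e, (∀ v, v ∈ B ↔ v = a ∨ v = b ∨ v = c ∨ v = d ∨ v = e) →
      IsPentagon G a b c d e → (∀ v, G.Adj a v → v ∈ B) ∨ (∀ v, G.Adj b v → v ∈ B) := by
    intro a b c d e hmem hp
    by_contra! h
    obtain ⟨⟨a', h1, h2⟩, b', h3, h4⟩ := h
    exact h𝓑.not_adj_outer hG hB hmem hp h1 h2 h3 h4
  have m1 : ∀ v, v ∈ B ↔ v = b ∨ v = c ∨ v = d ∨ v = e ∨ v = a := fun v => by rw [hmem]; tauto
  have m2 : ∀ v, v ∈ B ↔ v = c ∨ v = d ∨ v = e ∨ v = a ∨ v = b := fun v => by rw [hmem]; tauto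
  have m3 : ∀ v, v ∈ B ↔ v = d ∨ v = e ∨ v = a ∨ v = b ∨ v = c := fun v => by rw [hmem]; tauto
  have m4 : ∀ v, v ∈ B ↔ v = e ∨ v = a ∨ v = b ∨ v = c ∨ v = d := fun v => by rw [hmem]; tauto
  have p1 := hp.rotate
  have p2 := p1.rotate
  have p3 := p2.rotate
  have p4 := p3.rotate
  have g0 := main _ _ _ _ _ hmem hp
  have g1 := main _ _ _ _ _ m1 p1
  have g2 := main _ _ _ _ _ m2 p2
  have g3 := main _ _ _ _ _ m3 p3
  have g4 := main _ _ _ _ _ m4 p4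
  have h0 := hno _ _ _ _ _ hmem hp
  have h1 := hno _ _ _ _ _ m1 p1
  have h2 := hno _ _ _ _ _ m2 p2
  have h3 := hno _ _ _ _ _ m3 p3
  have h4 := hno _ _ _ _ _ m4 p4
  exact pentagon_cases h0 h1 h2 h3 h4 g0 g1 g2 g3 g4

end BlockShapes

section Ranking
variable {V : Type} {G : SimpleGraph V} {α : ℕ} {𝓑 : Finset (Finset V)} {B : Finset V}

/-- The values of the ranking `ρ` on the block `B` are compatible with the shape of `B`. -/
inductive IsBlockRank (G : SimpleGraph V) (B : Finset V) (ρ : V → ℕ) : Prop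
  | simplex (z : V) (h : IsSimplexAt G B z) (hz : ρ z = 4) (hne : ∀ b ∈ B, b ≠ z → ρ b = 1)
  | square (z w z' w' : V) (h : IsSquareEdge G B z w z' w') (hz : ρ z = 2) (hw : ρ w = 4)
  | pentagon (a b c d e : V) (h : IsPentagonAt G B a b c d e) (ha : ρ a = 1) (hb : ρ b = 2)
      (hc : ρ c = 1) (hd : ρ d = 3) (he : ρ e = 4)

lemma IsBlockRank.congr {ρ ρ' : V → ℕ} (h : IsBlockRank G B ρ) (hρ : ∀ b ∈ B, ρ' b = ρ b) :
    IsBlockRank G B ρ' := by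
  cases h with
  | simplex z h hz hne =>
    exact .simplex z h (by rw [hρ z h.mem, hz]) fun b hb hbz => by rw [hρ b hb, hne b hb hbz]
  | square z w z' w' h hz hw =>
    have := h.mem_iff
    exact .square z w z' w' h (by rw [hρ z (by simp [this]), hz])
      (by rw [hρ w (by simp [this]), hw])
  | pentagon a b c d e h ha hb hc hd he =>
    have := h.mem_iff
    exact .pentagon a b c d e h (by rw [hρ a (by simp [this]), ha])
      (by rw [hρ b (by simp [this]), hb]) (by rw [hρ c (by simp [this]), hc])
      (by rw [hρ d (by simp [this]), hd]) (by rw [hρ e (by simp [this]), he])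

lemma IsSimplexAt.exists_isBlockRank {z : V} (h : IsSimplexAt G B z) : ∃ ρ, IsBlockRank G B ρ := by
  classical
  exact ⟨fun v => if v = z then 4 else 1, .simplex z h (by simp) fun b _ hb => by simp [hb]⟩

lemma IsSquareEdge.exists_isBlockRank {z w z' w' : V} (h : IsSquareEdge G B z w z' w') :
    ∃ ρ, IsBlockRank G B ρ := by
  classical
  exact ⟨fun v => if v = z then 2 else 4, .square z w z' w' h (by simp) (by simp [h.adj.ne'])⟩

lemma IsPentagon.nodup {a b c d e : V} (h : IsPentagon G a b c d e) : [a, b, c, d, e].Nodup := by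
  have hac : a ≠ c := fun h' => h.da (h' ▸ h.cd.symm)
  have had : a ≠ d := fun h' => h.ac (h' ▸ h.cd.symm)
  have hbd : b ≠ d := fun h' => h.eb (h' ▸ h.de.symm)
  have hbe : b ≠ e := fun h' => h.bd (h' ▸ h.de.symm)
  have hce : c ≠ e := fun h' => h.ac (h' ▸ h.ea.symm)
  simp [h.ab.ne, h.bc.ne, h.cd.ne, h.de.ne, h.ea.ne', hac, had, hbd, hbe, hce]

lemma IsPentagonAt.exists_isBlockRank {a b c d e : V} (h : IsPentagonAt G B a b c d e) :
    ∃ ρ, IsBlockRank G B ρ := by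
  classical
  have := h.pentagon.nodup
  simp only [List.nodup_cons, List.mem_cons, List.not_mem_nil, or_false, not_or,
      List.nodup_nil, and_true, not_false_eq_true] at this
  obtain ⟨⟨hab, hac, had, hae⟩, ⟨hbc, hbd, hbe⟩, ⟨hcd, hce⟩, hde⟩ := this
  exact ⟨fun v => if v = b then 2 else if v = d then 3 else if v = e then 4 else 1,
    .pentagon a b c d e h (by simp [*]) (by simp) (by simp [*, Ne.symm hbc])
      (by simp [Ne.symm hbd]) (by simp [Ne.symm hbe, Ne.symm hde])⟩

lemma IsSquareEdge.symm {z w z' w' : V} (h : IsSquareEdge G B z w z' w') :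
    IsSquareEdge G B w z w' z' :=
  ⟨fun v => by rw [h.mem_iff, or_comm], h.adj.symm, h.adj_right, h.adj_left, h.adj_top.symm,
    h.right_notMem, h.left_notMem, h.nbr_right, h.nbr_left⟩

lemma Tame.not_fourCycle_component [Fintype V] (hG : Tame G α) {a b c d : V} (hab : G.Adj a b)
    (hbc : G.Adj b c) (hcd : G.Adj c d) (hda : G.Adj d a) (hac : a ≠ c)
    (ha : ∀ v, G.Adj a v → v = b ∨ v = d) (hb : ∀ v, G.Adj b v → v = a ∨ v = c)
    (hc : ∀ v, G.Adj c v → v = b ∨ v = d) (hd : ∀ v, G.Adj d v → v = a ∨ v = c) : False := by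
  obtain ⟨S, hS, hlink⟩ := hG.exists_link_eq (S := ∅) (by simp [indepCpx])
    (fun v => v = a ∨ v = b ∨ v = c ∨ v = d) (by simp [InLink]) (by
      rintro v w (rfl | rfl | rfl | rfl) ⟨hvw, -, -⟩
      · rcases ha w hvw with rfl | rfl <;> simp
      · rcases hb w hvw with rfl | rfl <;> simp
      · rcases hc w hvw with rfl | rfl <;> simp
      · rcases hd w hvw with rfl | rfl <;> simp)
  refine hG.not_four S hS a b c d (fun h => ?_) hac hab hbc hcd hda hlink
  rcases ha c h with rfl | rfl
  · exact G.loopless.irrefl _ hbc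
  · exact G.loopless.irrefl _ hcd

variable [DecidableEq V]

lemma IsBlockDecomposition.exists_ranking (h𝓑 : IsBlockDecomposition G α 𝓑) (hG : Tame G α) :
    ∃ ρ : V → ℕ, ∀ B ∈ 𝓑, IsBlockRank G B ρ := by
  have hloc : ∀ B ∈ 𝓑, ∃ ρ, IsBlockRank G B ρ := by
    intro B hB
    rcases h𝓑.block B hB with hc | hp
    · rcases h𝓑.shape_of_isCliqueBlock hG hB hc with ⟨z, h⟩ | ⟨z, w, z', w', h⟩
      · exact h.exists_isBlockRank
      · exact h.exists_isBlockRank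
    · obtain ⟨a, b, c, d, e, h⟩ := h𝓑.shape_of_isPentagonBlock hG hB hp
      exact h.exists_isBlockRank
  choose! r hr using hloc
  choose blk hblk hmem using h𝓑.exists_mem
  refine ⟨fun v => r (blk v) v, fun B hB => (hr B hB).congr fun b hb => ?_⟩
  rw [h𝓑.eq_of_mem _ (hblk b) B hB b (hmem b) hb]

lemma IsBlockDecomposition.rank_eq_one [Fintype V] (h𝓑 : IsBlockDecomposition G α 𝓑)
    (hG : Tame G α) {ρ : V → ℕ} (hρ : ∀ B ∈ 𝓑, IsBlockRank G B ρ) {z w z' w' : V}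
    (hB : B ∈ 𝓑) (h : IsSquareEdge G B z w z' w') : ρ z' = 1 := by
  obtain ⟨B', hB', hz'⟩ := h𝓑.exists_mem z'
  have hzB : z ∈ B := (h.mem_iff z).2 (.inl rfl)
  have hwB : w ∈ B := (h.mem_iff w).2 (.inr rfl)
  have hz : z ∉ B' := fun hz => h.left_notMem (h𝓑.eq_of_mem B hB B' hB' z hzB hz ▸ hz')
  have key : ∀ x y' x', ¬ IsSquareEdge G B' z' x y' x' := by
    intro x y' x' h'
    have hx : x ∈ B' := (h'.mem_iff x).2 (.inr rfl)
    have e1 : z = y' := (h'.nbr_left z h.adj_left.symm).resolve_left fun e => hz (e ▸ hx)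
    have e2 : w' = x := (h'.nbr_left w' h.adj_top).resolve_right fun e =>
      h.right_notMem (e.trans e1.symm ▸ hzB)
    have e3 : w = x' := (h'.nbr_right w (e2 ▸ h.adj_right.symm)).resolve_left fun e =>
      h.left_notMem (e ▸ hwB)
    subst e1 e2 e3
    exact hG.not_fourCycle_component h.adj h.adj_right h.adj_top.symm h.adj_left.symm
      (fun e => h.right_notMem (e ▸ hzB)) h.nbr_left h.nbr_right
      (fun v hv => (h'.nbr_right v hv).symm) fun v hv => (h'.nbr_left v hv).symm
  cases hρ B' hB' with
  | simplex y h' hy hne =>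
    refine hne z' hz' fun e => hz (h'.nbr z ?_)
    exact e ▸ h.adj_left.symm
  | square y x y' x' h' hy hx =>
    rcases (h'.mem_iff z').1 hz' with rfl | rfl
    · exact absurd h' (key _ _ _)
    · exact absurd h'.symm (key _ _ _)
  | pentagon a b c d e h' ha hb hc hd he =>
    have hadj := h.adj_left.symm
    rcases (h'.mem_iff z').1 hz' with rfl | rfl | rfl | rfl | rfl
    · exact ha
    · exact absurd ((h'.mem_iff z).2 (by have := h'.nbr_b z hadj; tauto)) hz
    · exact hc
    · exact absurd ((h'.mem_iff z).2 (by have := h'.nbr_d z hadj; tauto)) hz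
    · exact absurd ((h'.mem_iff z).2 (by have := h'.nbr_e z hadj; tauto)) hz

end Ranking

section Exchange
variable {V : Type} [DecidableEq V] {G : SimpleGraph V} {α : ℕ} {𝓑 : Finset (Finset V)}
  {B : Finset V} {ι : Type} [Fintype ι]

/-- The number of members of the family `M` containing `v`. -/
def occ (M : ι → Finset V) (v : V) : ℕ := ∑ i, if v ∈ M i then 1 else 0

/-- A family of independent sets of size `α`. -/
def IsFacetFamily (G : SimpleGraph V) (α : ℕ) (M : ι → Finset V) : Prop :=
  ∀ i, indepCpx G (M i) ∧ (M i).card = α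

/-- Replacing one occurrence of `q` in the family `M` by `p` is possible. -/
def IsExchange (G : SimpleGraph V) (α : ℕ) (M : ι → Finset V) (q p : V) : Prop :=
  ∃ M' : ι → Finset V, IsFacetFamily G α M' ∧
    ∀ v, occ M' v + (if v = q then 1 else 0) = occ M v + if v = p then 1 else 0

lemma exists_mem_of_occ_pos {M : ι → Finset V} {q : V} (h : 0 < occ M q) : ∃ i, q ∈ M i := by
  by_contra! h'
  simp [occ, h'] at h

lemma occ_update [DecidableEq ι] (M : ι → Finset V) (i : ι) (N : Finset V) (v : V) :
    occ (Function.update M i N) v + (if v ∈ M i then 1 else 0) =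
      occ M v + if v ∈ N then 1 else 0 := by
  have h1 := Finset.add_sum_erase Finset.univ
    (fun j => if v ∈ Function.update M i N j then 1 else 0) (Finset.mem_univ i)
  have h2 := Finset.add_sum_erase Finset.univ (fun j => if v ∈ M j then 1 else 0)
    (Finset.mem_univ i)
  have h3 : ∑ j ∈ Finset.univ.erase i, (if v ∈ Function.update M i N j then 1 else 0) =
      ∑ j ∈ Finset.univ.erase i, if v ∈ M j then 1 else 0 := by
    refine Finset.sum_congr rfl fun j hj => ?_
    rw [Function.update_of_ne (Finset.ne_of_mem_erase hj)]
  simp only [Function.update_self] at h1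
  unfold occ
  omega

lemma IsFacetFamily.update [DecidableEq ι] {M : ι → Finset V} (hM : IsFacetFamily G α M) (i : ι)
    {N : Finset V} (hN : indepCpx G N) (hcard : N.card = α) :
    IsFacetFamily G α (Function.update M i N) := by
  intro j
  by_cases h : j = i
  · subst h
    rw [Function.update_self]
    exact ⟨hN, hcard⟩
  · rw [Function.update_of_ne h]
    exact hM j

lemma IsFacetFamily.isExchange_of_nbr {M : ι → Finset V} (hM : IsFacetFamily G α M) {i : ι}
    {q p : V} (hq : q ∈ M i) (hp : p ∉ M i) (hpq : ∀ v, G.Adj p v → v ∈ M i → v = q) :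
    IsExchange G α M q p := by
  classical
  have hp' : p ∉ (M i).erase q := fun h => hp (Finset.mem_of_mem_erase h)
  refine ⟨Function.update M i (insert p ((M i).erase q)), hM.update i ?_ ?_, fun v => ?_⟩
  · refine indepCpx_insert ((hM i).1.subset (Finset.erase_subset _ _)) fun v hv hvp => ?_
    rw [Finset.mem_erase] at hv
    exact hv.1 (hpq v hvp.symm hv.2)
  · rw [Finset.card_insert_of_notMem hp', Finset.card_erase_add_one hq, (hM i).2]
  · have h := occ_update M i (insert p ((M i).erase q)) v
    simp only [Finset.mem_insert, Finset.mem_erase] at h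
    by_cases h1 : v = q
    · subst h1
      have : v ≠ p := fun e => hp (e ▸ hq)
      simp only [hq, this, if_true, if_false, ne_eq, not_true_eq_false, false_and, or_false] at h ⊢
      omega
    · by_cases h2 : v = p
      · subst h2
        simp only [hp, h1, if_true, if_false, true_or] at h ⊢
        omega
      · simp only [h1, h2, if_false, ne_eq, not_false_eq_true, true_and, false_or] at h ⊢
        omega

lemma IsFacetFamily.isExchange_of_pair [Fintype V] (hG : Tame G α) {M : ι → Finset V}
    (hM : IsFacetFamily G α M) {i j : ι} (hij : i ≠ j) {N N' : Finset V} {q p : V}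
    (hN : indepCpx G N) (hN' : indepCpx G N')
    (h : ∀ v, (if v ∈ N then 1 else 0) + (if v ∈ N' then 1 else 0) + (if v = q then 1 else 0) =
      (if v ∈ M i then 1 else 0) + (if v ∈ M j then 1 else 0) + if v = p then 1 else 0) :
    IsExchange G α M q p := by
  classical
  have hcard : N.card + N'.card = α + α := by
    have := Finset.sum_congr (rfl : (Finset.univ : Finset V) = Finset.univ) fun v _ => h v
    simp only [Finset.sum_add_distrib, Finset.sum_ite_mem, Finset.univ_inter, Finset.sum_const,
      smul_eq_mul, mul_one, Finset.sum_ite_eq', Finset.mem_univ, if_true, (hM _).2] at this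
    omega
  have h1 := hG.card_le N hN
  have h2 := hG.card_le N' hN'
  refine ⟨Function.update (Function.update M i N) j N',
    (hM.update i hN (by omega)).update j hN' (by omega), fun v => ?_⟩
  have h3 := occ_update M i N v
  have h4 := occ_update (Function.update M i N) j N' v
  rw [Function.update_of_ne hij.symm] at h4
  have h5 := h v
  omega

lemma IsBlockDecomposition.sum_occ (h𝓑 : IsBlockDecomposition G α 𝓑) (hB : B ∈ 𝓑)
    {M : ι → Finset V} (hM : IsFacetFamily G α M) :
    ∑ b ∈ B, occ M b = Fintype.card ι * blockWeight G B := by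
  simp only [occ]
  rw [Finset.sum_comm]
  have : ∀ i, ∑ b ∈ B, (if b ∈ M i then 1 else 0) = blockWeight G B := by
    intro i
    rw [← h𝓑.card_inter B hB _ (hM i).1 (hM i).2, Finset.sum_boole, Finset.inter_comm,
      Finset.filter_mem_eq_inter]
    rfl
  simp [this]

lemma IsBlockDecomposition.occ_eq (h𝓑 : IsBlockDecomposition G α 𝓑) (hB : B ∈ 𝓑)
    {M N : ι → Finset V} (hM : IsFacetFamily G α M) (hN : IsFacetFamily G α N) {q : V}
    (hq : q ∈ B) (h : ∀ b ∈ B, b ≠ q → occ M b = occ N b) : occ M q = occ N q := by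
  have h1 := h𝓑.sum_occ hB hM
  rw [← h𝓑.sum_occ hB hN, ← Finset.add_sum_erase B _ hq, ← Finset.add_sum_erase B _ hq,
    Finset.sum_congr rfl fun b hb => h b (Finset.mem_of_mem_erase hb)
      (Finset.ne_of_mem_erase hb)] at h1
  exact Nat.add_right_cancel h1

end Exchange

section PentagonExchange
variable {V : Type} [DecidableEq V] {G : SimpleGraph V} {α : ℕ} {𝓑 : Finset (Finset V)}
  {B : Finset V} {ι : Type} [Fintype ι] {a b c d e : V}

lemma IsBlockDecomposition.sum_indicator_pentagon (h𝓑 : IsBlockDecomposition G α 𝓑) (hB : B ∈ 𝓑)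
    (h : IsPentagonAt G B a b c d e) {M : Finset V} (hM : indepCpx G M) (hcard : M.card = α) :
    (if a ∈ M then 1 else 0) + (if b ∈ M then 1 else 0) + (if c ∈ M then 1 else 0) +
      (if d ∈ M then 1 else 0) + (if e ∈ M then 1 else 0) = 2 := by
  have hnd := h.pentagon.nodup
  have hB' : B = [a, b, c, d, e].toFinset := by
    ext v
    simp [h.mem_iff]
  have := h𝓑.card_inter B hB M hM hcard
  rw [blockWeight, if_neg (IsPentagonBlock.not_isCliqueBlock ⟨a, b, c, d, e, h.mem_iff,
    h.pentagon⟩), Finset.inter_comm, ← Finset.filter_mem_eq_inter, Finset.card_filter, hB',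
    List.sum_toFinset _ hnd] at this
  simpa [add_assoc] using this

lemma IsBlockDecomposition.indicator_left (h𝓑 : IsBlockDecomposition G α 𝓑) (hB : B ∈ 𝓑)
    (h : IsPentagonAt G B a b c d e) {M : Finset V} (hM : indepCpx G M) (hcard : M.card = α) :
    (if a ∈ M ∧ c ∈ M then 1 else 0) + 1 =
      (if a ∈ M then 1 else 0) + (if b ∈ M then 1 else 0) + if c ∈ M then 1 else 0 := by
  have hs := h𝓑.sum_indicator_pentagon hB h hM hcard
  have hab := fun h1 h2 => hM a h1 b h2 h.pentagon.ab
  have hbc := fun h1 h2 => hM b h1 c h2 h.pentagon.bc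
  have hcd := fun h1 h2 => hM c h1 d h2 h.pentagon.cd
  have hde := fun h1 h2 => hM d h1 e h2 h.pentagon.de
  have hea := fun h1 h2 => hM e h1 a h2 h.pentagon.ea
  by_cases ha : a ∈ M <;> by_cases hb : b ∈ M <;> by_cases hc : c ∈ M <;> by_cases hd : d ∈ M <;>
    by_cases he : e ∈ M <;> simp [ha, hb, hc, hd, he] at hs hab hbc hcd hde hea ⊢

lemma IsBlockDecomposition.indicator_right (h𝓑 : IsBlockDecomposition G α 𝓑) (hB : B ∈ 𝓑)
    (h : IsPentagonAt G B a b c d e) {M : Finset V} (hM : indepCpx G M) (hcard : M.card = α) :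
    (if d ∈ M ∧ a ∉ M then 1 else 0) + 1 =
      (if d ∈ M then 1 else 0) + (if b ∈ M then 1 else 0) + if c ∈ M then 1 else 0 := by
  have hs := h𝓑.sum_indicator_pentagon hB h hM hcard
  have hab := fun h1 h2 => hM a h1 b h2 h.pentagon.ab
  have hbc := fun h1 h2 => hM b h1 c h2 h.pentagon.bc
  have hcd := fun h1 h2 => hM c h1 d h2 h.pentagon.cd
  have hde := fun h1 h2 => hM d h1 e h2 h.pentagon.de
  have hea := fun h1 h2 => hM e h1 a h2 h.pentagon.ea
  by_cases ha : a ∈ M <;> by_cases hb : b ∈ M <;> by_cases hc : c ∈ M <;> by_cases hd : d ∈ M <;>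
    by_cases he : e ∈ M <;> simp [ha, hb, hc, hd, he] at hs hab hbc hcd hde hea ⊢

lemma sum_indicator_add_card {P : ι → Prop} [DecidablePred P] {M : ι → Finset V} {x y z : V}
    (h : ∀ i, (if P i then 1 else 0) + 1 =
      (if x ∈ M i then 1 else 0) + (if y ∈ M i then 1 else 0) + if z ∈ M i then 1 else 0) :
    (∑ i, if P i then 1 else 0) + Fintype.card ι = occ M x + occ M y + occ M z := by
  have := Finset.sum_congr (rfl : (Finset.univ : Finset ι) = Finset.univ) fun i _ => h i
  rw [Finset.sum_add_distrib, Finset.sum_add_distrib, Finset.sum_add_distrib] at this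
  simpa [occ] using this

/-- The part of `G` which is attached to the rest of `G` through the vertex `c` of a pentagon. -/
lemma Tame.exists_branch [Fintype V] (hG : Tame G α) (h : IsPentagonAt G B a b c d e) :
    ∃ D : Finset V, c ∈ D ∧ a ∉ D ∧ b ∉ D ∧ d ∉ D ∧ e ∉ D ∧
      ∀ u ∈ D, ∀ v ∉ D, G.Adj u v → u = c ∧ (v = b ∨ v = d) := by
  classical
  have hp := h.pentagon
  have hnd := hp.nodup
  simp only [List.nodup_cons, List.mem_cons, List.not_mem_nil, or_false, not_or,
      List.nodup_nil, and_true, not_false_eq_true] at hnd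
  obtain ⟨⟨hab, hac, had, hae⟩, ⟨hbc, hbd, hbe⟩, ⟨hcd, hce⟩, hde⟩ := hnd
  let D : Finset V := Finset.univ.filter fun v =>
    v = c ∨ ∃ u, G.Adj c u ∧ u ≠ b ∧ u ≠ d ∧ ConnAvoiding G c u v
  have mem_D : ∀ v, v ∈ D ↔ v = c ∨ ∃ u, G.Adj c u ∧ u ≠ b ∧ u ≠ d ∧ ConnAvoiding G c u v := by
    simp [D]
  have hcl : ∀ u ∈ D, u ≠ c → ∀ v, G.Adj u v → v ∈ D := by
    intro u hu huc v huv
    rw [mem_D] at hu ⊢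
    by_cases hv : v = c
    · exact .inl hv
    · obtain ⟨w, h1, h2, h3, h4⟩ := hu.resolve_left huc
      exact .inr ⟨w, h1, h2, h3, h4.trans (.of_adj huv (Ne.symm huc) (Ne.symm hv))⟩
  have hdb : ConnAvoiding G c d b := ((ConnAvoiding.of_adj hp.de hcd hce).trans
    (.of_adj hp.ea hce (Ne.symm hac))).trans (.of_adj hp.ab (Ne.symm hac) (Ne.symm hbc))
  have hb : b ∉ D := by
    intro hb
    obtain ⟨u, h1, h2, h3, h4⟩ := ((mem_D b).1 hb).resolve_left hbc
    exact hG.not_conn c b u d hp.bc.symm h1 hp.cd h2 (Ne.symm hbd) h3 h4 hdb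
  have ha : a ∉ D := fun ha => hb (hcl a ha hac b hp.ab)
  have he : e ∉ D := fun he => ha (hcl e he (Ne.symm hce) a hp.ea)
  have hd : d ∉ D := fun hd => he (hcl d hd (Ne.symm hcd) e hp.de)
  refine ⟨D, by simp [mem_D], ha, hb, hd, he, fun u hu v hv huv => ?_⟩
  have huc : u = c := by
    by_contra huc
    exact hv (hcl u hu huc v huv)
  subst huc
  refine ⟨rfl, ?_⟩
  by_contra! hne
  exact hv ((mem_D v).2 (.inr ⟨v, huv, hne.1, hne.2, .refl huv.ne⟩))

lemma Tame.isExchange_pentagon [Fintype V] (hG : Tame G α) (h𝓑 : IsBlockDecomposition G α 𝓑)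
    (hB : B ∈ 𝓑) (h : IsPentagonAt G B a b c d e) {M : ι → Finset V} (hM : IsFacetFamily G α M)
    {i j : ι} (hai : a ∈ M i) (hci : c ∈ M i) (hbj : b ∈ M j) :
    IsExchange G α M b d ∨ IsExchange G α M b e := by
  have hp := h.pentagon
  have hnd := hp.nodup
  simp only [List.nodup_cons, List.mem_cons, List.not_mem_nil, or_false, not_or,
      List.nodup_nil, and_true, not_false_eq_true] at hnd
  obtain ⟨⟨hab, hac, had, hae⟩, ⟨hbc, hbd, hbe⟩, ⟨hcd, hce⟩, hde⟩ := hnd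
  obtain ⟨D, hcD, haD, hbD, hdD, heD, hD⟩ := hG.exists_branch h
  have hMi := (hM i).1
  have hMj := (hM j).1
  have hbi : b ∉ M i := fun h' => hMi a hai b h' hp.ab
  have hdi : d ∉ M i := fun h' => hMi c hci d h' hp.cd
  have hei : e ∉ M i := fun h' => hMi e h' a hai hp.ea
  have haj : a ∉ M j := fun h' => hMj a h' b hbj hp.ab
  have hcj : c ∉ M j := fun h' => hMj b hbj c h' hp.bc
  have hij : i ≠ j := fun h' => hbi (h' ▸ hbj)
  have hdej : d ∈ M j ↔ e ∉ M j := by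
    have := h𝓑.sum_indicator_pentagon hB h hMj (hM j).2
    by_cases h1 : d ∈ M j <;> by_cases h2 : e ∈ M j <;> simp [*] at this ⊢
  let N : Finset V := insert d ((M i \ D) ∪ (M j ∩ D))
  let N' : Finset V := insert e (((M j \ D) \ {b, d}) ∪ (M i ∩ D))
  have hN : indepCpx G N := by
    refine indepCpx_insert ?_ ?_
    · intro u hu v hv huv
      simp only [Finset.mem_union, Finset.mem_sdiff, Finset.mem_inter] at hu hv
      rcases hu with hu | hu <;> rcases hv with hv | hv
      · exact hMi u hu.1 v hv.1 huv
      · exact hcj ((hD v hv.2 u hu.2 huv.symm).1 ▸ hv.1)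
      · exact hcj ((hD u hu.2 v hv.2 huv).1 ▸ hu.1)
      · exact hMj u hu.1 v hv.1 huv
    · intro u hu hud
      simp only [Finset.mem_union, Finset.mem_sdiff, Finset.mem_inter] at hu
      rcases h.nbr_d u hud.symm with rfl | rfl
      · exact hu.elim (fun h' => h'.2 hcD) fun h' => hcj h'.1
      · exact hu.elim (fun h' => hei h'.1) fun h' => heD h'.2
  have hN' : indepCpx G N' := by
    refine indepCpx_insert ?_ ?_
    · intro u hu v hv huv
      simp only [Finset.mem_union, Finset.mem_sdiff, Finset.mem_inter, Finset.mem_insert,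
        Finset.mem_singleton] at hu hv
      rcases hu with hu | hu <;> rcases hv with hv | hv
      · exact hMj u hu.1.1 v hv.1.1 huv
      · exact hu.2 (hD v hv.2 u hu.1.2 huv.symm).2
      · exact hv.2 (hD u hu.2 v hv.1.2 huv).2
      · exact hMi u hu.1 v hv.1 huv
    · intro u hu hue
      simp only [Finset.mem_union, Finset.mem_sdiff, Finset.mem_inter, Finset.mem_insert,
        Finset.mem_singleton] at hu
      rcases h.nbr_e u hue.symm with rfl | rfl
      · exact hu.elim (fun h' => h'.2 (.inr rfl)) fun h' => hdD h'.2
      · exact hu.elim (fun h' => haj h'.1.1) fun h' => haD h'.2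
  have hcases : ∀ v, v = b ∨ v = d ∨ v = e ∨ (v ≠ b ∧ v ≠ d ∧ v ≠ e) := fun v => by tauto
  by_cases hdj : d ∈ M j
  · right
    have hej := hdej.1 hdj
    refine hM.isExchange_of_pair hG hij hN hN' fun v => ?_
    rcases hcases v with rfl | rfl | rfl | ⟨h1, h2, h3⟩
    · simp [N, N', hbD, hbi, hbj, hbd, hbe]
    · simp [N, N', hdD, hdi, hdj, Ne.symm hbd, hde]
    · simp [N, N', heD, hei, hej, Ne.symm hbe, Ne.symm hde]
    · by_cases hv : v ∈ D <;> simp [N, N', hv, h1, h2, h3, add_comm]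
  · left
    have hej : e ∈ M j := by
      by_contra h'
      exact hdj (hdej.2 h')
    refine hM.isExchange_of_pair hG hij hN hN' fun v => ?_
    rcases hcases v with rfl | rfl | rfl | ⟨h1, h2, h3⟩
    · simp [N, N', hbD, hbi, hbj, hbd, hbe]
    · simp [N, N', hdD, hdi, hdj, Ne.symm hbd, hde]
    · simp [N, N', heD, hei, hej, Ne.symm hbe, Ne.symm hde]
    · by_cases hv : v ∈ D <;> simp [N, N', hv, h1, h2, h3, add_comm]

end PentagonExchange

section MainExchange
variable {V : Type} [DecidableEq V] {G : SimpleGraph V} {α : ℕ} {𝓑 : Finset (Finset V)}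
  {B : Finset V} {ι : Type} [Fintype ι]

lemma IsSimplexAt.isExchange {z q : V} (h : IsSimplexAt G B z) {M : ι → Finset V}
    (hM : IsFacetFamily G α M) {i : ι} (hq : q ∈ B) (hqz : q ≠ z) (hqi : q ∈ M i) :
    IsExchange G α M q z := by
  refine hM.isExchange_of_nbr hqi
    (fun hz => (hM i).1 q hqi z hz (h.clique q hq z h.mem hqz)) fun v hzv hv => ?_
  by_contra hne
  exact (hM i).1 v hv q hqi (h.clique v (h.nbr v hzv) q hq hne)

lemma IsSquareEdge.isExchange (h𝓑 : IsBlockDecomposition G α 𝓑) (hB : B ∈ 𝓑) {z w z' w' : V}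
    (h : IsSquareEdge G B z w z' w') {M N : ι → Finset V} (hM : IsFacetFamily G α M)
    (hN : IsFacetFamily G α N) (hw' : occ M w' = occ N w') (hlt : occ N z < occ M z) :
    IsExchange G α M z w := by
  by_cases hex : ∃ i, z ∈ M i ∧ w' ∉ M i
  · obtain ⟨i, hz, hi⟩ := hex
    refine hM.isExchange_of_nbr hz (fun hw => (hM i).1 z hz w hw h.adj) fun v hwv hv => ?_
    exact (h.nbr_right v hwv).resolve_right fun h' => hi (h' ▸ hv)
  · push Not at hex
    have h1 : occ M z ≤ occ M w' := by
      refine Finset.sum_le_sum fun i _ => ?_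
      have := hex i
      split_ifs <;> simp_all
    have h2 : occ N w' ≤ occ N z := by
      refine Finset.sum_le_sum fun i _ => ?_
      by_cases hi : w' ∈ N i
      · have hz : z ∈ N i := by
          have hc := h𝓑.card_inter B hB _ (hN i).1 (hN i).2
          have : 0 < (N i ∩ B).card := by
            rw [hc, blockWeight]
            split_ifs <;> simp
          obtain ⟨v, hv⟩ := Finset.card_pos.mp this
          rw [Finset.mem_inter, h.mem_iff] at hv
          rcases hv.2 with rfl | rfl
          · exact hv.1
          · exact absurd h.adj_right ((hN i).1 _ hv.1 _ hi)
        simp [hi, hz]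
      · simp [hi]
    omega

lemma IsBlockDecomposition.exists_isExchange [Fintype V] (h𝓑 : IsBlockDecomposition G α 𝓑)
    (hG : Tame G α) {ρ : V → ℕ} (hρ : ∀ B ∈ 𝓑, IsBlockRank G B ρ) {M N : ι → Finset V}
    (hM : IsFacetFamily G α M) (hN : IsFacetFamily G α N) {q : V}
    (hq : ∀ p, ρ p < ρ q → occ M p = occ N p) (hlt : occ N q < occ M q) :
    ∃ p, ρ q < ρ p ∧ IsExchange G α M q p := by
  obtain ⟨B, hB, hqB⟩ := h𝓑.exists_mem q
  obtain ⟨i, hi⟩ := exists_mem_of_occ_pos (Nat.zero_lt_of_lt hlt)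
  have hMi := (hM i).1
  have top : (∀ b ∈ B, b ≠ q → ρ b < ρ q) → False := fun h =>
    hlt.ne' (h𝓑.occ_eq hB hM hN hqB fun b hb hbq => hq b (h b hb hbq))
  cases hρ B hB with
  | simplex z h hz hne =>
    by_cases hqz : q = z
    · subst hqz
      exact (top fun b hb hbq => by rw [hne b hb hbq, hz]; norm_num).elim
    · exact ⟨z, by rw [hne q hqB hqz, hz]; norm_num, h.isExchange hM hqB hqz hi⟩
  | square z w z' w' h hz hw =>
    rcases (h.mem_iff q).1 hqB with rfl | rfl
    · refine ⟨w, by omega, h.isExchange h𝓑 hB hM hN (hq w' ?_) hlt⟩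
      rw [h𝓑.rank_eq_one hG hρ hB h.symm, hz]
      norm_num
    · refine (top fun b hb hbq => ?_).elim
      rw [((h.mem_iff b).1 hb).resolve_right hbq, hz, hw]
      norm_num
  | pentagon a b c d e h ha hb hc hd he =>
    have hp := h.pentagon
    rcases (h.mem_iff q).1 hqB with rfl | rfl | rfl | rfl | rfl
    · by_cases hci : c ∈ M i
      · refine ⟨e, by omega, hM.isExchange_of_nbr hi (fun h' => hMi e h' q hi hp.ea)
          fun v hv hvi => (h.nbr_e v hv).resolve_left fun h' => ?_⟩
        exact hMi c hci v hvi (h' ▸ hp.cd)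
      · refine ⟨b, by omega, hM.isExchange_of_nbr hi (fun h' => hMi q hi b h' hp.ab)
          fun v hv hvi => (h.nbr_b v hv).resolve_right fun h' => hci (h' ▸ hvi)⟩
    · have hl : ∀ {M : ι → Finset V}, IsFacetFamily G α M → _ := fun {M} hM =>
        sum_indicator_add_card (ι := ι) fun i => h𝓑.indicator_left hB h (hM i).1 (hM i).2
      have h1 := hl hM
      have h2 := hl hN
      rw [hq a (by omega), hq c (by omega)] at h1
      have hpos : 0 < ∑ i, if a ∈ M i ∧ c ∈ M i then 1 else 0 := by omega
      obtain ⟨k, hk⟩ : ∃ k, a ∈ M k ∧ c ∈ M k := by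
        simpa [Finset.filter_nonempty_iff] using hpos
      rcases hG.isExchange_pentagon h𝓑 hB h hM hk.1 hk.2 hi with h' | h'
      · exact ⟨d, by omega, h'⟩
      · exact ⟨e, by omega, h'⟩
    · by_cases hai : a ∈ M i
      · refine ⟨d, by omega, hM.isExchange_of_nbr hi (fun h' => hMi q hi d h' hp.cd)
          fun v hv hvi => (h.nbr_d v hv).resolve_right fun h' => ?_⟩
        exact hMi v hvi a hai (h' ▸ hp.ea)
      · refine ⟨b, by omega, hM.isExchange_of_nbr hi (fun h' => hMi b h' q hi hp.bc)
          fun v hv hvi => (h.nbr_b v hv).resolve_left fun h' => hai (h' ▸ hvi)⟩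
    · have hl : ∀ {M : ι → Finset V}, IsFacetFamily G α M → _ := fun {M} hM =>
        sum_indicator_add_card (ι := ι) fun i => h𝓑.indicator_right hB h (hM i).1 (hM i).2
      have h1 := hl hM
      have h2 := hl hN
      rw [hq b (by omega), hq c (by omega)] at h1
      have hpos : 0 < ∑ i, if q ∈ M i ∧ a ∉ M i then 1 else 0 := by omega
      obtain ⟨k, hk⟩ : ∃ k, q ∈ M k ∧ a ∉ M k := by
        simpa [Finset.filter_nonempty_iff] using hpos
      refine ⟨e, by omega, hM.isExchange_of_nbr hk.1 (fun h' => (hM k).1 q hk.1 e h' hp.de)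
        fun v hv hvi => (h.nbr_e v hv).resolve_right fun h' => hk.2 (h' ▸ hvi)⟩
    · refine (top fun v hv hvq => ?_).elim
      rcases (h.mem_iff v).1 hv with rfl | rfl | rfl | rfl | rfl
      · omega
      · omega
      · omega
      · omega
      · exact absurd rfl hvq

end MainExchange

section CoverPowers
variable {V : Type} [Fintype V] [DecidableEq V] {G : SimpleGraph V} {α : ℕ}

lemma Tame.isMinimalVertexCover_iff (hG : Tame G α) (F : Finset V) :
    IsMinimalVertexCover G F ↔ indepCpx G Fᶜ ∧ Fᶜ.card = α := by
  have cover : ∀ F, IsVertexCover G F ↔ indepCpx G Fᶜ := by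
    intro F
    simp only [IsVertexCover, indepCpx, Finset.mem_compl]
    refine forall_congr' fun v => ⟨fun h hv w hw hvw => (h w hvw).elim hv hw, fun h w hvw => ?_⟩
    by_contra! hn
    exact h hn.1 w hn.2 hvw
  constructor
  · rintro ⟨hF, hmin⟩
    obtain ⟨M, hFM, hM, hcard⟩ := hG.exists_extend _ ((cover F).1 hF)
    have : Mᶜ = F := hmin _ (by rw [← compl_compl F]; exact Finset.compl_subset_compl.mpr hFM) ((cover _).2 (by rwa [compl_compl]))
    rw [← this, compl_compl]
    exact ⟨hM, hcard⟩
  · rintro ⟨hF, hcard⟩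
    refine ⟨(cover F).2 hF, fun F' hF' hc => ?_⟩
    have := Finset.eq_of_subset_of_card_le (Finset.compl_subset_compl.mpr hF')
      (hcard ▸ hG.card_le _ ((cover F').1 hc))
    exact (compl_injective this).symm

lemma Tame.coverIdeal_pow_eq (hG : Tame G α) (s : ℕ) :
    coverIdeal K G ^ s = Ideal.span ((fun a => monomial a (1 : K)) ''
      {a : V →₀ ℕ | ∃ M : Fin s → Finset V, IsFacetFamily G α M ∧ ∀ v, a v + occ M v = s}) := by
  have hprod : ∀ F : Finset V, ∏ v ∈ F, X v = monomial (sqf F) (1 : K) := fun F => by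
    rw [sqf, monomial_sum_one]
    rfl
  have hocc : ∀ (M : Fin s → Finset V) v, (∑ i, sqf (M i)ᶜ) v + occ M v = s := by
    intro M v
    rw [Finsupp.finsetSum_apply, occ, ← Finset.sum_add_distrib]
    trans ∑ _i : Fin s, 1
    · refine Finset.sum_congr rfl fun i _ => ?_
      rw [sqf_apply]
      by_cases h : v ∈ M i <;> simp [h]
    · simp
  rw [coverIdeal, Ideal.span, Submodule.span_pow]
  refine congrArg (Submodule.span _) (Set.ext fun m => ?_)
  rw [Set.mem_pow_iff_prod]
  constructor
  · rintro ⟨f, hf, rfl⟩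
    choose F hF hF' using hf
    refine ⟨∑ i, sqf (F i), ⟨fun i => (F i)ᶜ, fun i => (hG.isMinimalVertexCover_iff _).1 (hF i),
      fun v => ?_⟩, ?_⟩
    · simpa using hocc (fun i => (F i)ᶜ) v
    · simp only [monomial_sum_one]
      exact Finset.prod_congr rfl fun i _ => by rw [hF', hprod]
  · rintro ⟨a, ⟨M, hM, ha⟩, rfl⟩
    refine ⟨fun i => monomial (sqf (M i)ᶜ) 1, fun i => ⟨(M i)ᶜ, ?_, (hprod _).symm⟩, ?_⟩
    · rw [hG.isMinimalVertexCover_iff, compl_compl]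
      exact hM i
    · rw [← monomial_sum_one]
      congr 2
      ext v
      have := hocc M v
      have := ha v
      omega

lemma Tame.isMonoMinGen_iff (hG : Tame G α) (s : ℕ) (a : V →₀ ℕ) :
    IsMonoMinGen K (coverIdeal K G ^ s) a ↔
      ∃ M : Fin s → Finset V, IsFacetFamily G α M ∧ ∀ v, a v + occ M v = s := by
  have hmem : ∀ b : V →₀ ℕ, monomial b (1 : K) ∈ coverIdeal K G ^ s ↔
      ∃ e : V →₀ ℕ, (∃ M : Fin s → Finset V, IsFacetFamily G α M ∧ ∀ v, e v + occ M v = s) ∧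
        e ≤ b := by
    intro b
    classical
    rw [hG.coverIdeal_pow_eq K s, mem_ideal_span_monomial_image, support_monomial,
      if_neg one_ne_zero]
    simp
  have hdeg : ∀ e : V →₀ ℕ, (∃ M : Fin s → Finset V, IsFacetFamily G α M ∧
      ∀ v, e v + occ M v = s) → ∑ v, e v + s * α = Fintype.card V * s := by
    rintro e ⟨M, hM, he⟩
    have h1 : ∑ v, occ M v = s * α := by
      simp only [occ]
      rw [Finset.sum_comm]
      simp [(hM _).2]
    rw [← h1, ← Finset.sum_add_distrib, Finset.sum_congr rfl fun v _ => he v]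
    simp
  constructor
  · rintro ⟨ha, hmin⟩
    obtain ⟨e, he, hea⟩ := (hmem a).1 ha
    rwa [← hmin e ((hmem e).2 ⟨e, he, le_rfl⟩) hea]
  · intro ha
    refine ⟨(hmem a).2 ⟨a, ha, le_rfl⟩, fun b hb hba => ?_⟩
    obtain ⟨e, he, heb⟩ := (hmem b).1 hb
    have h1 := hdeg a ha
    have h2 := hdeg e he
    have h3 : ∀ v ∈ Finset.univ, e v = a v :=
      (Finset.sum_eq_sum_iff_of_le fun v _ => (heb.trans hba) v).1 (by omega)
    refine le_antisymm hba fun v => ?_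
    rw [← h3 v (Finset.mem_univ v)]
    exact heb v

end CoverPowers

theorem coverIdeal_pow_weaklyPolymatroidal_of_CM_cactus
    (V : Type) [Fintype V] [DecidableEq V] (G : SimpleGraph V)
    (hcactus : IsCactus G)
    (hCM : IsCohenMacaulayQuot K (edgeIdeal K G))
    (s : ℕ) (hs : 1 ≤ s) :
    ∃ r : LinearOrder V, WeaklyPolymatroidalWrt K r.lt (coverIdeal K G ^ s) := by
  obtain ⟨α, hG⟩ := exists_tame hcactus hCM
  obtain ⟨𝓑, h𝓑⟩ := hG.exists_isBlockDecomposition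
  obtain ⟨ρ, hρ⟩ := h𝓑.exists_ranking hG
  let f : V → ℕ ×ₗ Fin (Fintype.card V) := fun v => toLex (ρ v, Fintype.equivFin V v)
  have hf : Function.Injective f := fun v w h => by
    have := congrArg (fun x => (ofLex x).2) h
    exact (Fintype.equivFin V).injective this
  refine ⟨LinearOrder.lift' f hf, fun a b ha hb q hq hlt => ?_⟩
  have lt_of_rank : ∀ p p', ρ p < ρ p' → (LinearOrder.lift' f hf).lt p p' := fun p p' h =>
    show f p < f p' from Prod.Lex.toLex_lt_toLex.mpr (.inl h)
  obtain ⟨M, hM, haM⟩ := (hG.isMonoMinGen_iff K s a).1 ha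
  obtain ⟨N, hN, hbN⟩ := (hG.isMonoMinGen_iff K s b).1 hb
  obtain ⟨p, hqp, M', hM', hocc⟩ := h𝓑.exists_isExchange hG hρ hM hN (q := q)
    (fun p hp => by
      have := hq p (lt_of_rank p q hp)
      have := haM p
      have := hbN p
      omega)
    (by
      have := haM q
      have := hbN q
      omega)
  have hpq : p ≠ q := by
    rintro rfl
    exact lt_irrefl _ hqp
  have hle : ∀ v, occ M' v ≤ s := fun v => by
    calc occ M' v ≤ ∑ _i : Fin s, 1 := Finset.sum_le_sum fun i _ => by split_ifs <;> simp
      _ = s := by simp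
  have hp : 0 < a p := by
    have h1 := hocc p
    have h2 := hle p
    have h3 := haM p
    simp only [hpq, if_false, if_true] at h1
    omega
  refine ⟨p, lt_of_rank q p hqp, hp, (hG.isMonoMinGen_iff K s _).2 ⟨M', hM', fun v => ?_⟩⟩
  have h1 := hocc v
  have h2 := haM v
  simp only [Finsupp.tsub_apply, Finsupp.add_apply, Finsupp.single_apply, eq_comm (a := q),
    eq_comm (a := p)]
  by_cases hvp : v = p
  · subst hvp
    simp only [hpq, if_false, if_true] at h1 ⊢
    omega
  · simp only [hvp, if_false] at h1 ⊢
    omega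

end Stmt
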